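/- arXiv:math/0405494 — 4 statements merged into one kernel-verified Lean document; each statement's English description precedes it below -/
import Mathlib

section
/- Let ℱ be a right-continuous filtration on (Ω, 𝒜, P) (ℱ_t = ⋂_{s>t} ℱ_s for all t < T) and let (ℱⁿ) be filtrations with ℱⁿ_t ⊆ ℱ_t for every n and t. Let (τⁿ) be a sequence of ℱⁿ-stopping times with τⁿ ≤ L. Then there exist a randomized ℱ-stopping time τ* and a strictly increasing map φ : ℕ → ℕ such that τ^{*,φ(n)} converges to τ* in the sense of Baxter and Chacon, where τ^{*,n}(ω,v) = τⁿ(ω). -/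
open MeasureTheory Filter Set Topology

noncomputable section

/-- A real-valued path is càdlàg on `[0, T]` : right-continuous on `[0,T)` and
with left limits on `(0,T]`. -/
def IsCadlagOn (T : ℝ) (f : ℝ → ℝ) : Prop :=
  (∀ t ∈ Set.Ico (0 : ℝ) T, Filter.Tendsto f (nhdsWithin t (Set.Ioi t)) (nhds (f t))) ∧
  (∀ t ∈ Set.Ioc (0 : ℝ) T, ∃ l : ℝ, Filter.Tendsto f (nhdsWithin t (Set.Iio t)) (nhds l))

/-- The jump of a path at time `t` : `Δf_t = f t - f (t⁻)`. -/
def pathJump (f : ℝ → ℝ) (t : ℝ) : ℝ := f t - Function.leftLim f t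

/-- The natural filtration `ℱ^X_t = σ(X_s : 0 ≤ s ≤ t)` of a process. -/
def natFilt {Ω : Type*} (X : ℝ → Ω → ℝ) (t : ℝ) : MeasurableSpace Ω :=
  ⨆ s ∈ Set.Icc (0 : ℝ) t, MeasurableSpace.comap (X s) (borel ℝ)

/-- The right-continuous filtration associated with the natural filtration of `X` :
`ℱ_t = ⋂_{s > t} ℱ^X_s` (for `t < T`), and `ℱ_T = ℱ^X_T`. -/
def rcFilt {Ω : Type*} (X : ℝ → Ω → ℝ) (T t : ℝ) : MeasurableSpace Ω :=
  if t < T then ⨅ s ∈ Set.Ioc t T, natFilt X s else natFilt X T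

/-- `τ` is a stopping time for the family of σ-fields `F`. -/
def IsStoppingTimeOn {Ω : Type*} (F : ℝ → MeasurableSpace Ω) (τ : Ω → ℝ) : Prop :=
  ∀ t : ℝ, MeasurableSet[F t] {ω | τ ω ≤ t}

/-- The value in optimal stopping with horizon `L`, for the filtration `F`,
the process `X` and the gain function `γ`. -/
def optValue {Ω : Type*} [MeasurableSpace Ω] (P : Measure Ω) (F : ℝ → MeasurableSpace Ω)
    (X : ℝ → Ω → ℝ) (γ : ℝ → ℝ → ℝ) (L : ℝ) : ℝ :=
  sSup {x | ∃ τ : Ω → ℝ, IsStoppingTimeOn F τ ∧ (∀ ω, τ ω ∈ Set.Icc 0 L) ∧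
    x = ∫ ω, γ (τ ω) (X (τ ω) ω) ∂P}

/-- The value in optimal stopping with horizon `L` over stopping times taking their
values in the finite set `s`. -/
def optValueIn {Ω : Type*} [MeasurableSpace Ω] (P : Measure Ω) (F : ℝ → MeasurableSpace Ω)
    (X : ℝ → Ω → ℝ) (γ : ℝ → ℝ → ℝ) (L : ℝ) (s : Finset ℝ) : ℝ :=
  sSup {x | ∃ τ : Ω → ℝ, IsStoppingTimeOn F τ ∧ (∀ ω, τ ω ∈ Set.Icc 0 L) ∧
    (∀ ω, τ ω ∈ s) ∧ x = ∫ ω, γ (τ ω) (X (τ ω) ω) ∂P}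

/-- Convergence in probability for the Skorokhod topology, expressed through random
time changes `Λⁿ`. -/
def SkorokhodTendstoP {Ω : Type*} [MeasurableSpace Ω] (P : Measure Ω) (T : ℝ)
    (Xn : ℕ → ℝ → Ω → ℝ) (X : ℝ → Ω → ℝ) : Prop :=
  ∃ Λ : ℕ → Ω → ℝ → ℝ,
    (∀ n ω, ContinuousOn (Λ n ω) (Set.Icc 0 T)) ∧
    (∀ n ω, StrictMonoOn (Λ n ω) (Set.Icc 0 T)) ∧
    (∀ n ω, Λ n ω 0 = 0) ∧
    (∀ n ω, Λ n ω T = T) ∧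
    (∀ n ω, Set.MapsTo (Λ n ω) (Set.Icc 0 T) (Set.Icc 0 T)) ∧
    (∀ ε : ℝ, 0 < ε → Filter.Tendsto
      (fun n => P {ω | ∃ t ∈ Set.Icc (0 : ℝ) T, ε ≤ |Xn n (Λ n ω t) ω - X t ω|})
      Filter.atTop (nhds 0)) ∧
    (∀ ε : ℝ, 0 < ε → Filter.Tendsto
      (fun n => P {ω | ∃ t ∈ Set.Icc (0 : ℝ) T, ε ≤ |Λ n ω t - t|})
      Filter.atTop (nhds 0))

/-- A càdlàg version of the conditional expectation `E[1_A | m]`. -/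
def cev {Ω : Type*} [MeasurableSpace Ω] (P : Measure Ω) (m : MeasurableSpace Ω)
    (A : Set Ω) : Ω → ℝ :=
  P[Set.indicator A (fun _ => (1 : ℝ)) | m]

/-- Weak convergence of the filtrations `Fn` to `F` : for every `A ∈ F T`, càdlàg
versions of the martingales `t ↦ E[1_A | Fn n t]` converge in probability, for the
Skorokhod topology, to a càdlàg version of `t ↦ E[1_A | F t]`. -/
def WeaklyTendstoFilt {Ω : Type*} [MeasurableSpace Ω] (P : Measure Ω) (T : ℝ)
    (Fn : ℕ → ℝ → MeasurableSpace Ω) (F : ℝ → MeasurableSpace Ω) : Prop :=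
  ∀ A : Set Ω, MeasurableSet[F T] A →
    ∃ (Mn : ℕ → ℝ → Ω → ℝ) (M : ℝ → Ω → ℝ),
      (∀ n, ∀ t ∈ Set.Icc (0 : ℝ) T, Mn n t =ᵐ[P] cev P (Fn n t) A) ∧
      (∀ t ∈ Set.Icc (0 : ℝ) T, M t =ᵐ[P] cev P (F t) A) ∧
      (∀ n ω, IsCadlagOn T (fun t => Mn n t ω)) ∧
      (∀ ω, IsCadlagOn T (fun t => M t ω)) ∧
      SkorokhodTendstoP P T Mn M

/-- The product of `P` with Lebesgue measure on `[0,1]`, on `Ω × ℝ` (modelling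
`Ω × [0,1]`). -/
def prodLeb {Ω : Type*} [MeasurableSpace Ω] (P : Measure Ω) : Measure (Ω × ℝ) :=
  P.prod ((volume : Measure ℝ).restrict (Set.Icc 0 1))

/-- The successor of `x` in the finite set `s` (and `x` itself if there is none). -/
def nextPt (s : Finset ℝ) (x : ℝ) : ℝ :=
  WithTop.untopD x (Finset.min (s.filter (fun y => x < y)))

end

lemma bc_hilbert {E ι : Type*} [NormedAddCommGroup E] [InnerProductSpace ℝ E] [CompleteSpace E]
    [Countable ι] (x : ι → ℕ → E) (hx : ∀ q n, ‖x q n‖ ≤ 1) :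
    ∃ (φ : ℕ → ℕ) (y : ι → E), StrictMono φ ∧
      ∀ q z, Tendsto (fun n => inner ℝ (x q (φ n)) z) atTop (𝓝 (inner ℝ (y q) z)) := by
  let K : Submodule ℝ E := (Submodule.span ℝ (range (Function.uncurry x))).topologicalClosure
  have hKc : IsClosed (K : Set E) := Submodule.isClosed_topologicalClosure _
  have : CompleteSpace K := hKc.completeSpace_coe
  have hsep : TopologicalSpace.IsSeparable (K : Set E) := by
    have h1 : TopologicalSpace.IsSeparable (range (Function.uncurry x)) :=
      (countable_range _).isSeparable
    have h2 := TopologicalSpace.IsSeparable.span (R := ℝ) h1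
    have := h2.closure
    simpa [K, Submodule.topologicalClosure_coe] using this
  have : TopologicalSpace.SeparableSpace K := hsep.separableSpace
  have hxK : ∀ q n, x q n ∈ K := fun q n =>
    Submodule.le_topologicalClosure _ (Submodule.subset_span ⟨(q, n), rfl⟩)
  let B : Set (WeakDual ℝ K) := WeakDual.toStrongDual ⁻¹' Metric.closedBall 0 1
  have hB : IsCompact B := WeakDual.isCompact_closedBall (𝕜 := ℝ) (E := K) 0 1
  have : TopologicalSpace.MetrizableSpace B := WeakDual.metrizable_of_isCompact ℝ K B hB
  have : CompactSpace B := isCompact_iff_compactSpace.1 hB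
  let u : ℕ → ι → B := fun n q =>
    ⟨StrongDual.toWeakDual (innerSL ℝ (⟨x q n, hxK q n⟩ : K)), by
      have h1 : ‖innerSL ℝ (⟨x q n, hxK q n⟩ : K)‖ ≤ 1 := by
        rw [innerSL_apply_norm]
        exact hx q n
      exact (dist_zero_right (innerSL ℝ (⟨x q n, hxK q n⟩ : K))).trans_le h1⟩
  obtain ⟨a, φ, hφ, ha⟩ := SeqCompactSpace.tendsto_subseq u
  refine ⟨φ, fun q => ((InnerProductSpace.toDual ℝ K).symm (WeakDual.toStrongDual (a q : WeakDual ℝ K)) : K), hφ, ?_⟩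
  intro q z
  have h1 : Tendsto (fun n => ((u (φ n) q : B) : WeakDual ℝ K)) atTop (𝓝 (a q : WeakDual ℝ K)) :=
    (continuous_subtype_val.tendsto _).comp (((continuous_apply q).tendsto _).comp ha)
  have h2 := ((WeakDual.eval_continuous (𝕜 := ℝ) (K.orthogonalProjectionOnto z)).tendsto _).comp h1
  have e : ∀ w : K, inner ℝ (w : E) z = inner ℝ w (K.orthogonalProjectionOnto z) := by
    intro w
    rw [Submodule.inner_orthogonalProjectionOnto_eq_of_mem_left]
  simp only [e]
  rw [InnerProductSpace.toDual_symm_apply]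
  refine h2.congr fun n => ?_
  exact (e ⟨x q (φ n), hxK q (φ n)⟩).symm

lemma bc_hilbert_mem {E : Type*} [NormedAddCommGroup E] [InnerProductSpace ℝ E] 
    (M : Submodule ℝ E) [CompleteSpace M] (x : ℕ → E) (y : E) (hx : ∀ n, x n ∈ M)
    (h : ∀ z, Tendsto (fun n => inner ℝ (x n) z) atTop (𝓝 (inner ℝ y z))) : y ∈ M := by
  rw [← Submodule.orthogonal_orthogonal M, Submodule.mem_orthogonal']
  intro z hz
  refine tendsto_nhds_unique (h z) ?_
  have : ∀ n, inner ℝ (x n) z = 0 := fun n => (Submodule.mem_orthogonal _ _).1 hz _ (hx n)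
  simp [this]

lemma bc_real (a : ℕ → ℝ → ℝ) (ha : ∀ n, Monotone (a n)) (A : ℝ → ℝ) (t : ℝ)
    (hA : ContinuousAt A t)
    (h : ∀ q : ℚ, ∃ l, Tendsto (fun n => a n q) atTop (𝓝 l) ∧ (∀ s < (q : ℝ), A s ≤ l) ∧ l ≤ A q) :
    Tendsto (fun n => a n t) atTop (𝓝 (A t)) := by
  rw [tendsto_order]
  constructor
  · intro b hb
    have := hA.eventually (lt_mem_nhds hb)
    obtain ⟨δ, hδ, h1⟩ := Metric.eventually_nhds_iff.1 this
    obtain ⟨q, hq1, hq2⟩ := exists_rat_btwn (show t - δ/2 < t by linarith)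
    obtain ⟨l, hl, hl1, hl2⟩ := h q
    have h3 : b < l := lt_of_lt_of_le (h1 (y := t - δ/2) (by rw [Real.dist_eq, abs_lt]; constructor <;> linarith)) (hl1 _ hq1)
    filter_upwards [hl.eventually (lt_mem_nhds h3)] with n hn
    exact hn.trans_le (ha n hq2.le)
  · intro b hb
    have := hA.eventually (gt_mem_nhds hb)
    obtain ⟨δ, hδ, h1⟩ := Metric.eventually_nhds_iff.1 this
    obtain ⟨q, hq1, hq2⟩ := exists_rat_btwn (show t < t + δ by linarith)
    obtain ⟨l, hl, hl1, hl2⟩ := h q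
    have h3 : l < b := lt_of_le_of_lt hl2 (h1 (y := q) (by rw [Real.dist_eq, abs_lt]; constructor <;> linarith))
    filter_upwards [hl.eventually (gt_mem_nhds h3)] with n hn
    exact (ha n hq1.le).trans_lt hn


lemma bc_unif (a : ℕ → ℝ) (A : ℝ)
    (h : ∀ ε > 0, ∃ (b : ℕ → ℝ) (B : ℝ), Tendsto b atTop (𝓝 B) ∧ (∀ n, |a n - b n| ≤ ε) ∧
      |A - B| ≤ ε) : Tendsto a atTop (𝓝 A) := by
  rw [Metric.tendsto_atTop]
  intro ε hε
  obtain ⟨b, B, hb, h1, h2⟩ := h (ε / 4) (by linarith)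
  obtain ⟨N, hN⟩ := Metric.tendsto_atTop.1 hb (ε / 4) (by linarith)
  refine ⟨N, fun n hn => ?_⟩
  have h3 := hN n hn
  have h4 := h1 n
  rw [Real.dist_eq] at *
  rw [abs_lt] at *
  rw [abs_le] at *
  constructor <;> linarith

lemma bc_weak {Ω : Type*} [m0 : MeasurableSpace Ω] (P : Measure Ω) [IsProbabilityMeasure P]
    (F : ℝ → MeasurableSpace Ω) (hFmono : Monotone F) (hFle : ∀ t, F t ≤ m0)
    (g : ℚ → ℕ → Ω → ℝ) (hg : ∀ (q : ℚ) n, Measurable[F q] (g q n))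
    (hg0 : ∀ q n ω, 0 ≤ g q n ω) (hg1 : ∀ q n ω, g q n ω ≤ 1)
    (hgm : ∀ n ω, Monotone fun q => g q n ω) :
    ∃ (φ : ℕ → ℕ) (H : ℚ → Ω → ℝ), StrictMono φ ∧ (∀ q : ℚ, Measurable[F q] (H q)) ∧
      (∀ q ω, 0 ≤ H q ω) ∧ (∀ q ω, H q ω ≤ 1) ∧ (∀ ω, Monotone fun q => H q ω) ∧
      ∀ q (Y : Ω → ℝ), Integrable Y P →
        Tendsto (fun n => ∫ ω, Y ω * g q (φ n) ω ∂P) atTop (𝓝 (∫ ω, Y ω * H q ω ∂P)) := by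
  have hgM : ∀ q n, Measurable (g q n) := fun q n => (hg q n).mono (hFle q) le_rfl
  have hgb : ∀ q n ω, ‖g q n ω‖ ≤ 1 := fun q n ω => by
    rw [Real.norm_eq_abs, abs_of_nonneg (hg0 q n ω)]; exact hg1 q n ω
  have hgL : ∀ q n, MemLp (g q n) 2 P := fun q n =>
    MemLp.of_bound (hgM q n).aestronglyMeasurable 1 (Eventually.of_forall (hgb q n))
  let x : ℚ → ℕ → Lp ℝ 2 P := fun q n => (hgL q n).toLp (g q n)
  have hx : ∀ q n, ‖x q n‖ ≤ 1 := by
    intro q n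
    have := Lp.norm_le_of_ae_bound (f := x q n) (C := 1) zero_le_one (by
      filter_upwards [(hgL q n).coeFn_toLp] with ω hω
      rw [hω]; exact hgb q n ω)
    simpa [measureUnivNNReal] using this
  obtain ⟨φ, y, hφ, hy⟩ := bc_hilbert x hx
  have hymem : ∀ q : ℚ, AEStronglyMeasurable[F q] (y q) P := by
    intro q
    have : Fact (F q ≤ m0) := ⟨hFle q⟩
    have := bc_hilbert_mem (lpMeas ℝ ℝ (F q) 2 P) (fun n => x q (φ n)) (y q) (fun n => by
      rw [mem_lpMeas_iff_aestronglyMeasurable]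
      exact (hg q (φ n)).stronglyMeasurable.aestronglyMeasurable.congr (hgL q (φ n)).coeFn_toLp.symm)
      (hy q)
    exact mem_lpMeas_iff_aestronglyMeasurable.1 this
  have hyi : ∀ q, Integrable (y q) P := fun q => (Lp.memLp (y q)).integrable (by norm_num)
  have hgi : ∀ q n, Integrable (g q n) P := fun q n => (hgL q n).integrable (by norm_num)
  have hset : ∀ q (s : Set Ω), MeasurableSet s →
      Tendsto (fun n => ∫ ω in s, g q (φ n) ω ∂P) atTop (𝓝 (∫ ω in s, y q ω ∂P)) := by
    intro q s hs
    have h1 := hy q (indicatorConstLp 2 hs (measure_ne_top P s) (1 : ℝ))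
    simp only [real_inner_comm (indicatorConstLp 2 hs (measure_ne_top P s) (1 : ℝ)),
      L2.inner_indicatorConstLp_one] at h1
    refine h1.congr fun n => ?_
    exact integral_congr_ae (ae_restrict_of_ae (hgL q (φ n)).coeFn_toLp)
  have hy0 : ∀ q, ∀ᵐ ω ∂P, 0 ≤ y q ω := by
    intro q
    refine ae_nonneg_of_forall_setIntegral_nonneg (hyi q) fun s hs _ => ?_
    exact ge_of_tendsto' (hset q s hs) fun n => integral_nonneg (hg0 q _)
  have hy1 : ∀ q, ∀ᵐ ω ∂P, y q ω ≤ 1 := by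
    intro q
    refine ae_le_of_forall_setIntegral_le (hyi q) (integrable_const 1) fun s hs _ => ?_
    exact le_of_tendsto' (hset q s hs) fun n => 
      integral_mono (hgi q _).integrableOn (integrable_const 1) (hg1 q _)
  have hym : ∀ q r, q ≤ r → ∀ᵐ ω ∂P, y q ω ≤ y r ω := by
    intro q r hqr
    refine ae_le_of_forall_setIntegral_le (hyi q) (hyi r) fun s hs _ => ?_
    exact le_of_tendsto_of_tendsto' (hset q s hs) (hset r s hs) fun n => 
      integral_mono (hgi q _).integrableOn (hgi r _).integrableOn fun ω => hgm _ ω hqr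
  let z : ℚ → Ω → ℝ := fun q ω => max 0 (min 1 ((hymem q).mk (y q) ω))
  have hzm : ∀ q : ℚ, Measurable[F q] (z q) := fun q =>
    measurable_const.max (measurable_const.min (hymem q).stronglyMeasurable_mk.measurable)
  have hz0 : ∀ q ω, 0 ≤ z q ω := fun q ω => le_max_left _ _
  have hz1 : ∀ q ω, z q ω ≤ 1 := fun q ω => max_le zero_le_one (min_le_left _ _)
  have hzy : ∀ q, ∀ᵐ ω ∂P, z q ω = y q ω := by
    intro q
    filter_upwards [(hymem q).ae_eq_mk, hy0 q, hy1 q] with ω h1 h2 h3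
    simp only [z, ← h1]
    rw [min_eq_right h3, max_eq_right h2]
  let H : ℚ → Ω → ℝ := fun q ω => ⨆ r : {r : ℚ // r ≤ q}, z r ω
  have hbdd : ∀ q ω, BddAbove (range fun r : {r : ℚ // r ≤ q} => z r ω) := fun q ω =>
    ⟨1, by rintro _ ⟨r, rfl⟩; exact hz1 _ _⟩
  have hHy : ∀ q, ∀ᵐ ω ∂P, H q ω = y q ω := by
    intro q
    have h1 : ∀ᵐ ω ∂P, ∀ r : {r : ℚ // r ≤ q}, y r ω ≤ y q ω :=
      ae_all_iff.2 fun r => hym r q r.2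
    filter_upwards [h1, ae_all_iff.2 hzy] with ω h2 h3
    have : Nonempty {r : ℚ // r ≤ q} := ⟨⟨q, le_rfl⟩⟩
    apply le_antisymm
    · exact ciSup_le fun r => by rw [h3]; exact h2 r
    · rw [← h3]; exact le_ciSup (hbdd q ω) ⟨q, le_rfl⟩
  have hH0 : ∀ q ω, 0 ≤ H q ω := fun q ω => Real.iSup_nonneg fun r => hz0 _ _
  have hH1 : ∀ q ω, H q ω ≤ 1 := fun q ω => Real.iSup_le (fun r => hz1 _ _) zero_le_one
  have hHm : ∀ q : ℚ, Measurable[F q] (H q) := fun q =>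
    Measurable.iSup fun r => (hzm r).mono (hFmono (by exact_mod_cast r.2)) le_rfl
  have hHM : ∀ q, Measurable (H q) := fun q => (hHm q).mono (hFle q) le_rfl
  have hHb : ∀ q ω, ‖H q ω‖ ≤ 1 := fun q ω => by
    rw [Real.norm_eq_abs, abs_of_nonneg (hH0 q ω)]; exact hH1 q ω
  refine ⟨φ, H, hφ, hHm, hH0, hH1, ?_, ?_⟩
  · intro ω q r hqr
    have : Nonempty {r : ℚ // r ≤ q} := ⟨⟨q, le_rfl⟩⟩
    exact ciSup_le fun s => le_ciSup (hbdd r ω) ⟨s, s.2.trans hqr⟩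
  intro q Y hY
  have key : ∀ (Y Z : Ω → ℝ) (h : Ω → ℝ), Integrable Y P → Integrable Z P → Measurable h →
      (∀ ω, ‖h ω‖ ≤ 1) →
      |∫ ω, Y ω * h ω ∂P - ∫ ω, Z ω * h ω ∂P| ≤ ∫ ω, ‖Y ω - Z ω‖ ∂P := by
    intro Y Z h hY hZ hh hb
    have hb' : ∀ᵐ ω ∂P, ‖h ω‖ ≤ 1 := Eventually.of_forall hb
    rw [← integral_sub (hY.mul_bdd hh.aestronglyMeasurable hb')
      (hZ.mul_bdd hh.aestronglyMeasurable hb'), ← Real.norm_eq_abs]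
    refine norm_integral_le_of_norm_le (hY.sub hZ).norm (Eventually.of_forall fun ω => ?_)
    rw [← sub_mul, norm_mul]
    exact mul_le_of_le_one_right (norm_nonneg _) (hb ω)
  refine Integrable.induction (fun Y => Tendsto (fun n => ∫ ω, Y ω * g q (φ n) ω ∂P) atTop
    (𝓝 (∫ ω, Y ω * H q ω ∂P))) ?_ ?_ ?_ ?_ hY
  · intro c s hs hfin
    have e : ∀ h : Ω → ℝ, ∫ ω, s.indicator (fun _ => c) ω * h ω ∂P = c * ∫ ω in s, h ω ∂P := by
      intro h
      rw [← integral_const_mul, ← integral_indicator hs]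
      congr 1; ext ω
      by_cases hω : ω ∈ s <;> simp [hω]
    simp only [e]
    refine Tendsto.const_mul c ?_
    rw [integral_congr_ae (ae_restrict_of_ae (hHy q))]
    exact hset q s hs
  · intro Y Z _ hYi hZi h1 h2
    have e : ∀ h : Ω → ℝ, Measurable h → (∀ ω, ‖h ω‖ ≤ 1) →
        ∫ ω, (Y + Z) ω * h ω ∂P = ∫ ω, Y ω * h ω ∂P + ∫ ω, Z ω * h ω ∂P := by
      intro h hh hb
      have hb' : ∀ᵐ ω ∂P, ‖h ω‖ ≤ 1 := Eventually.of_forall hb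
      rw [← integral_add (hYi.mul_bdd hh.aestronglyMeasurable hb')
        (hZi.mul_bdd hh.aestronglyMeasurable hb')]
      simp only [Pi.add_apply, add_mul]
    rw [e _ (hHM q) (hHb q)]
    simp only [e _ (hgM q _) (hgb q _)]
    exact h1.add h2
  · rw [← isSeqClosed_iff_isClosed]
    intro Yk Y hYk hlim
    apply bc_unif
    intro ε hε
    obtain ⟨N, hN⟩ := Metric.tendsto_atTop.1 hlim ε hε
    have h1 : ∫ ω, ‖Y ω - Yk N ω‖ ∂P ≤ ε := by
      simp only [← dist_eq_norm]
      rw [← L1.dist_eq_integral_dist, dist_comm]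
      exact (hN N le_rfl).le
    exact ⟨_, _, hYk N, fun n => (key _ _ _ (L1.integrable_coeFn _) (L1.integrable_coeFn _)
      (hgM q _) (hgb q _)).trans h1, (key _ _ _ (L1.integrable_coeFn _) (L1.integrable_coeFn _)
      (hHM q) (hHb q)).trans h1⟩
  · intro Y Z hYZ _ h1
    have e : ∀ h : Ω → ℝ, ∫ ω, Z ω * h ω ∂P = ∫ ω, Y ω * h ω ∂P := by
      intro h
      refine integral_congr_ae ?_
      filter_upwards [hYZ] with ω hω
      rw [hω]
    simpa only [e] using h1

lemma bc_grid {M : Type*} [MeasurableSpace M] (Q : Measure M) [IsFiniteMeasure Q] (L : ℝ)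
    (Y : M → ℝ) (hY : Integrable Y Q) (Xn : ℕ → M → ℝ) (hXn : ∀ n, Measurable (Xn n))
    (hXnL : ∀ n p, Xn n p ∈ Icc 0 L) (X : M → ℝ) (hX : Measurable X) (hXL : ∀ p, X p ∈ Icc 0 L)
    (D : Set ℝ) (hD : Dense D)
    (h : ∀ t ∈ D, Tendsto (fun n => ∫ p, Y p * (Iic t).indicator 1 (Xn n p) ∂Q) atTop
      (𝓝 (∫ p, Y p * (Iic t).indicator 1 (X p) ∂Q)))
    (f : ℝ → ℝ) (hf : Continuous f) :
    Tendsto (fun n => ∫ p, Y p * f (Xn n p) ∂Q) atTop (𝓝 (∫ p, Y p * f (X p) ∂Q)) := by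
  apply bc_unif
  intro ε hε
  have hC : 0 ≤ ∫ p, ‖Y p‖ ∂Q := integral_nonneg fun p => norm_nonneg _
  set C := ∫ p, ‖Y p‖ ∂Q with hCdef
  have hε' : 0 < ε / (C + 1) := by positivity
  have huc := isCompact_Icc.uniformContinuousOn_of_continuous
    (hf.continuousOn (s := Icc (-1) (L + 1)))
  obtain ⟨δ0, hδ0, hδ⟩ := Metric.uniformContinuousOn_iff.1 huc _ hε'
  obtain ⟨δ, hδpos, hδ1, hδ2⟩ : ∃ δ > 0, 2 * δ ≤ 1 ∧ 2 * δ ≤ δ0 :=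
    ⟨min (1/2) (δ0/2), by positivity, by linarith [min_le_left (1/2) (δ0/2)],
      by linarith [min_le_right (1/2) (δ0/2)]⟩
  have ht : ∀ i : ℕ, ∃ t ∈ D, ((i : ℝ) - 1) * δ < t ∧ t < i * δ := by
    intro i
    obtain ⟨t, h1, h2⟩ := hD.exists_between (show ((i : ℝ) - 1) * δ < i * δ by linarith)
    exact ⟨t, h1, h2⟩
  choose t htD ht1 ht2 using ht
  obtain ⟨N, hN⟩ := exists_nat_gt (L / δ + 1)
  have htN : L ≤ t N := by
    have : L / δ * δ = L := div_mul_cancel₀ _ hδpos.ne'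
    have h2 : L / δ * δ ≤ ((N : ℝ) - 1) * δ := by
      apply mul_le_mul_of_nonneg_right _ hδpos.le
      linarith
    linarith [ht1 N]
  have ht0 : t 0 < 0 := by simpa using ht2 0
  let I : ℝ → ℝ → ℝ := fun s => (Iic s).indicator 1
  have hI0 : ∀ s x, 0 ≤ I s x := fun s x => indicator_nonneg (fun _ _ => zero_le_one) _
  have hI1 : ∀ s x, I s x ≤ 1 := fun s x => indicator_le_self' (fun _ _ => zero_le_one) _
  have hIm : ∀ s, Measurable (I s) := fun s => measurable_one.indicator measurableSet_Iic
  let g : ℝ → ℝ := fun x => ∑ i ∈ Finset.range N, f (t (i+1)) * (I (t (i+1)) x - I (t i) x)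
  have hg : ∀ x ∈ Icc 0 L, |f x - g x| ≤ ε / (C + 1) := by
    intro x hx
    have h1 : ∑ i ∈ Finset.range N, (I (t (i+1)) x - I (t i) x) = 1 := by
      rw [Finset.sum_range_sub (fun i => I (t i) x)]
      simp [I, hx.2.trans htN, ht0.trans_le hx.1]
    have h2 : f x - g x = ∑ i ∈ Finset.range N, (f x - f (t (i+1))) * (I (t (i+1)) x - I (t i) x) := by
      simp only [sub_mul (f x), Finset.sum_sub_distrib, ← Finset.mul_sum, h1, g]
      ring
    rw [h2]
    calc _ ≤ ∑ i ∈ Finset.range N, |(f x - f (t (i+1))) * (I (t (i+1)) x - I (t i) x)| :=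
          Finset.abs_sum_le_sum_abs _ _
      _ ≤ ∑ i ∈ Finset.range N, (ε / (C + 1)) * (I (t (i+1)) x - I (t i) x) := by
          apply Finset.sum_le_sum
          intro i _
          have a1 := ht1 i
          have a2 := ht2 i
          have a3 := ht1 (i+1)
          have a4 := ht2 (i+1)
          push_cast at a3 a4
          by_cases c1 : x ≤ t i
          · have c2 : x ≤ t (i+1) := by linarith
            simp [I, c1, c2]
          · by_cases c2 : x ≤ t (i+1)
            · have c3 : t (i+1) - x < 2 * δ := by linarith
              have c4 : |f x - f (t (i+1))| < ε / (C + 1) := by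
                rw [← Real.dist_eq]
                apply hδ
                · exact ⟨by linarith [hx.1], by linarith [hx.2]⟩
                · exact ⟨by linarith [hx.1], by linarith [hx.2]⟩
                · rw [Real.dist_eq, abs_lt]; constructor <;> linarith
              simpa [I, c1, c2] using c4.le
            · simp [I, c1, c2]
      _ = _ := by rw [← Finset.mul_sum, h1, mul_one]
  have hYZi : ∀ s (Z : M → ℝ), Measurable Z → Integrable (fun p => Y p * I s (Z p)) Q := by
    intro s Z hZ
    refine hY.mul_bdd (c := 1) ((hIm s).comp hZ).aestronglyMeasurable (Eventually.of_forall fun p => ?_)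
    rw [Real.norm_eq_abs, abs_of_nonneg (hI0 _ _)]
    exact hI1 _ _
  have hgint : ∀ (Z : M → ℝ), Measurable Z → Integrable (fun p => Y p * g (Z p)) Q ∧
      ∫ p, Y p * g (Z p) ∂Q = ∑ i ∈ Finset.range N,
        f (t (i+1)) * (∫ p, Y p * I (t (i+1)) (Z p) ∂Q - ∫ p, Y p * I (t i) (Z p) ∂Q) := by
    intro Z hZ
    have e : ∀ p, Y p * g (Z p) = ∑ i ∈ Finset.range N,
        f (t (i+1)) * (Y p * I (t (i+1)) (Z p) - Y p * I (t i) (Z p)) := by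
      intro p
      simp only [g, Finset.mul_sum]
      exact Finset.sum_congr rfl fun i _ => by ring
    simp only [e]
    constructor
    · exact integrable_finsetSum _ fun i _ => ((hYZi _ Z hZ).sub (hYZi _ Z hZ)).const_mul _
    · rw [integral_finsetSum]
      swap
      · exact fun i _ => ((hYZi _ Z hZ).sub (hYZi _ Z hZ)).const_mul _
      refine Finset.sum_congr rfl fun i _ => ?_
      rw [integral_const_mul, integral_sub (hYZi _ Z hZ) (hYZi _ Z hZ)]
  obtain ⟨C', hC'⟩ := isCompact_Icc.exists_bound_of_continuousOn (hf.continuousOn (s := Icc 0 L))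
  have hdiff : ∀ (Z : M → ℝ), Measurable Z → (∀ p, Z p ∈ Icc 0 L) →
      |∫ p, Y p * f (Z p) ∂Q - ∫ p, Y p * g (Z p) ∂Q| ≤ ε := by
    intro Z hZ hZL
    have hfi : Integrable (fun p => Y p * f (Z p)) Q :=
      hY.mul_bdd (c := C') (hf.measurable.comp hZ).aestronglyMeasurable
        (Eventually.of_forall fun p => hC' _ (hZL p))
    rw [← integral_sub hfi (hgint Z hZ).1, ← Real.norm_eq_abs]
    have : ‖∫ p, (Y p * f (Z p) - Y p * g (Z p)) ∂Q‖ ≤ ∫ p, ‖Y p‖ * (ε / (C + 1)) ∂Q := by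
      refine norm_integral_le_of_norm_le (hY.norm.mul_const _) (Eventually.of_forall fun p => ?_)
      rw [← mul_sub, norm_mul]
      exact mul_le_mul_of_nonneg_left (hg _ (hZL p)) (norm_nonneg _)
    refine this.trans ?_
    rw [integral_mul_const, ← hCdef, mul_div_assoc', div_le_iff₀ (by positivity)]
    nlinarith
  refine ⟨fun n => ∫ p, Y p * g (Xn n p) ∂Q, ∫ p, Y p * g (X p) ∂Q, ?_,
    fun n => hdiff _ (hXn n) (hXnL n), hdiff _ hX hXL⟩
  rw [(hgint X hX).2]
  simp only [(hgint _ (hXn _)).2]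
  exact tendsto_finsetSum _ fun i _ => ((h _ (htD _)).sub (h _ (htD _))).const_mul _

lemma bc_main_nonneg {Ω : Type*} [m0 : MeasurableSpace Ω] (P : Measure Ω) [IsProbabilityMeasure P]
    (L : ℝ) (τ : ℕ → Ω → ℝ) (hτm : ∀ n, Measurable (τ n)) (hτL : ∀ n ω, τ n ω ∈ Icc 0 L)
    (H : ℚ → Ω → ℝ) (K : ℝ → Ω → ℝ) (hHM : ∀ q, Measurable (H q)) (hKM : ∀ t, Measurable (K t))
    (hH0 : ∀ q ω, 0 ≤ H q ω) (hH1 : ∀ q ω, H q ω ≤ 1)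
    (hK0 : ∀ t ω, 0 ≤ K t ω) (hK1 : ∀ t ω, K t ω ≤ 1)
    (hHK : ∀ q : ℚ, ∀ ω, H q ω ≤ K q ω) (hKH : ∀ (s : ℝ) (q : ℚ) ω, s < q → K s ω ≤ H q ω)
    (X : Ω × ℝ → ℝ) (hXm : Measurable X) (hXL : ∀ p, X p ∈ Icc 0 L)
    (hX : ∀ ω v t, X (ω, v) ≤ t ↔ L ≤ t ∨ (0 ≤ t ∧ v ≤ K t ω))
    (Y : Ω → ℝ) (hY : Integrable Y P) (hY0 : ∀ ω, 0 ≤ Y ω)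
    (hlim : ∀ q : ℚ, Tendsto (fun n => ∫ ω, Y ω * (Iic (q : ℝ)).indicator 1 (τ n ω) ∂P) atTop
      (𝓝 (∫ ω, Y ω * H q ω ∂P)))
    (f : ℝ → ℝ) (hf : Continuous f) :
    Tendsto (fun n => ∫ p, Y p.1 * f (τ n p.1) ∂(prodLeb P)) atTop
      (𝓝 (∫ p, Y p.1 * f (X p) ∂(prodLeb P))) := by
  have hvol : IsProbabilityMeasure ((volume : Measure ℝ).restrict (Icc 0 1)) :=
    ⟨by simp⟩
  have hQ : IsProbabilityMeasure (prodLeb P) := by unfold prodLeb; infer_instance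
  have hYQ : Integrable (fun p : Ω × ℝ => Y p.1) (prodLeb P) := hY.comp_fst _
  have hfst : ∀ g : Ω → ℝ, ∫ p, g p.1 ∂(prodLeb P) = ∫ ω, g ω ∂P := by
    intro g
    unfold prodLeb
    rw [integral_fun_fst]
    simp
  have hI0 : ∀ s x : ℝ, 0 ≤ (Iic s).indicator (1 : ℝ → ℝ) x :=
    fun s x => indicator_nonneg (fun _ _ => zero_le_one) _
  have hI1 : ∀ s x : ℝ, (Iic s).indicator (1 : ℝ → ℝ) x ≤ 1 :=
    fun s x => indicator_le_self' (fun _ _ => zero_le_one) _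
  have hIm : ∀ s : ℝ, Measurable ((Iic s).indicator (1 : ℝ → ℝ)) :=
    fun s => measurable_one.indicator measurableSet_Iic
  have hYZi : ∀ s (Z : Ω × ℝ → ℝ), Measurable Z →
      Integrable (fun p => Y p.1 * (Iic s).indicator 1 (Z p)) (prodLeb P) := by
    intro s Z hZ
    refine hYQ.mul_bdd (c := 1) ((hIm s).comp hZ).aestronglyMeasurable
      (Eventually.of_forall fun p => ?_)
    rw [Real.norm_eq_abs, abs_of_nonneg (hI0 _ _)]
    exact hI1 _ _
  have hIh : ∀ h : Ω → ℝ, Measurable h → (∀ ω, 0 ≤ h ω) → (∀ ω, h ω ≤ 1) →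
      Integrable (fun ω => Y ω * h ω) P := by
    intro h hm h0 h1
    refine hY.mul_bdd (c := 1) hm.aestronglyMeasurable (Eventually.of_forall fun p => ?_)
    rw [Real.norm_eq_abs, abs_of_nonneg (h0 _)]
    exact h1 _
  have hmono : ∀ (Z : Ω × ℝ → ℝ), Measurable Z →
      Monotone fun t => ∫ p, Y p.1 * (Iic t).indicator 1 (Z p) ∂(prodLeb P) := by
    intro Z hZ s t hst
    refine integral_mono (hYZi s Z hZ) (hYZi t Z hZ) fun p => ?_
    refine mul_le_mul_of_nonneg_left ?_ (hY0 _)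
    exact indicator_le_indicator_of_subset (Iic_subset_Iic.2 hst) (fun _ => zero_le_one) _
  let A : ℝ → ℝ := fun t => ∫ p, Y p.1 * (Iic t).indicator 1 (X p) ∂(prodLeb P)
  have hAmono : Monotone A := hmono X hXm
  have hAneg : ∀ t < 0, A t = 0 := by
    intro t ht
    have : ∀ p, ¬ X p ≤ t := fun p => not_le.2 (ht.trans_le (hXL p).1)
    simp [A, this]
  have hAbig : ∀ t, L ≤ t → A t = ∫ ω, Y ω ∂P := by
    intro t ht
    have : ∀ p, X p ≤ t := fun p => (hXL p).2.trans ht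
    simp [A, this, hfst]
  have hAmid : ∀ t, 0 ≤ t → t < L → A t = ∫ ω, Y ω * K t ω ∂P := by
    intro t h0 hL
    have h1 := hYZi t X hXm
    simp only [A]
    unfold prodLeb at h1 ⊢
    rw [integral_prod _ h1]
    refine integral_congr_ae (Eventually.of_forall fun ω => ?_)
    simp only
    rw [integral_const_mul]
    congr 1
    have e : ∀ v, (Iic t).indicator (1 : ℝ → ℝ) (X (ω, v)) = (Iic (K t ω)).indicator 1 v := by
      intro v
      have := hX ω v t
      by_cases hv : v ≤ K t ω
      · have h2 : X (ω, v) ≤ t := this.2 (Or.inr ⟨h0, hv⟩)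
        simp [hv, h2]
      · have h2 : ¬ X (ω, v) ≤ t := by
          rw [this]; rintro (h | h)
          · linarith
          · exact hv h.2
        simp [hv, h2]
    simp only [e]
    rw [integral_indicator_one measurableSet_Iic, measureReal_restrict_apply measurableSet_Iic]
    have : Iic (K t ω) ∩ Icc 0 1 = Icc 0 (K t ω) := by
      ext v
      simp only [mem_inter_iff, mem_Iic, mem_Icc]
      constructor
      · rintro ⟨a, b, c⟩; exact ⟨b, a⟩
      · rintro ⟨a, b⟩; exact ⟨b, a, b.trans (hK1 _ _)⟩
    rw [this, Real.volume_real_Icc_of_le (hK0 _ _), sub_zero]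
  refine bc_grid (prodLeb P) L _ hYQ (fun n p => τ n p.1) (fun n => (hτm n).comp measurable_fst)
    (fun n p => hτL n p.1) X hXm hXL {t | ContinuousAt A t} ?_ ?_ f hf
  · have := hAmono.countable_not_continuousAt.dense_compl ℝ
    convert this using 1
    ext t
    simp
  · intro t ht
    refine bc_real (fun n t => ∫ p, Y p.1 * (Iic t).indicator 1 (τ n p.1) ∂(prodLeb P))
      (fun n => hmono _ ((hτm n).comp measurable_fst)) A t ht ?_
    intro q
    have hl : Tendsto (fun n => ∫ p, Y p.1 * (Iic (q : ℝ)).indicator 1 (τ n p.1) ∂(prodLeb P)) atTop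
        (𝓝 (∫ ω, Y ω * H q ω ∂P)) := by
      refine (hlim q).congr fun n => ?_
      exact (hfst (fun ω => Y ω * (Iic (q : ℝ)).indicator 1 (τ n ω))).symm
    have hle1 : ∫ ω, Y ω * H q ω ∂P ≤ ∫ ω, Y ω ∂P :=
      integral_mono (hIh _ (hHM q) (hH0 q) (hH1 q)) hY
        fun ω => mul_le_of_le_one_right (hY0 ω) (hH1 q ω)
    have hge0 : 0 ≤ ∫ ω, Y ω * H q ω ∂P := integral_nonneg fun ω => mul_nonneg (hY0 ω) (hH0 q ω)
    refine ⟨_, hl, ?_, ?_⟩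
    · intro s hs
      rcases lt_or_ge s 0 with h0 | h0
      · rw [hAneg s h0]; exact hge0
      rcases lt_or_ge s L with h1 | h1
      · rw [hAmid s h0 h1]
        exact integral_mono (hIh _ (hKM s) (hK0 s) (hK1 s)) (hIh _ (hHM q) (hH0 q) (hH1 q))
          fun ω => mul_le_mul_of_nonneg_left (hKH s q ω hs) (hY0 ω)
      · rw [hAbig s h1]
        refine ge_of_tendsto' hl fun n => ?_
        have : ∀ ω, τ n ω ≤ q := fun ω => (hτL n ω).2.trans (h1.trans hs.le)
        simp [this, hfst]
    · rcases lt_or_ge (q : ℝ) 0 with h0 | h0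
      · rw [hAneg q h0]
        refine le_of_tendsto' hl fun n => ?_
        have : ∀ ω, ¬ τ n ω ≤ q := fun ω => not_le.2 (h0.trans_le (hτL n ω).1)
        simp [this]
      rcases lt_or_ge (q : ℝ) L with h1 | h1
      · rw [hAmid q h0 h1]
        exact integral_mono (hIh _ (hHM q) (hH0 q) (hH1 q)) (hIh _ (hKM q) (hK0 q) (hK1 q))
          fun ω => mul_le_mul_of_nonneg_left (hHK q ω) (hY0 ω)
      · rw [hAbig q h1]; exact hle1

lemma bc_meas {Ω : Type*} (m : MeasurableSpace Ω) (k : Ω → ℝ) (hk : Measurable k) :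
    MeasurableSet {p : Ω × ℝ | p.2 ≤ k p.1} :=
  measurableSet_le measurable_snd (hk.comp measurable_fst)

/-- (Baxter–Chacon compactness.) If `ℱ` is right-continuous,
`ℱⁿ_t ⊆ ℱ_t`, and `(τⁿ)` are `ℱⁿ`-stopping times bounded by `L`, then some
subsequence of the associated randomized stopping times converges in the sense of
Baxter and Chacon to a randomized `ℱ`-stopping time `τ*`. -/
theorem baxter_chacon_compactness
    {Ω : Type*} [m0 : MeasurableSpace Ω] (P : Measure Ω) [IsProbabilityMeasure P]
    (T L : ℝ) (hT : 0 < T) (hL : L ∈ Set.Icc 0 T)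
    (F : ℝ → MeasurableSpace Ω) (hFmono : Monotone F) (hFle : ∀ t, F t ≤ m0)
    (hFrc : ∀ t, t < T → F t = ⨅ s ∈ Set.Ioc t T, F s)
    (Fn : ℕ → ℝ → MeasurableSpace Ω) (hFn : ∀ n t, Fn n t ≤ F t)
    (τn : ℕ → Ω → ℝ) (hτn : ∀ n, IsStoppingTimeOn (Fn n) (τn n))
    (hτnL : ∀ n ω, τn n ω ∈ Set.Icc 0 L) :
    ∃ (τs : Ω × ℝ → ℝ) (φ : ℕ → ℕ), StrictMono φ ∧
      (∀ t : ℝ, MeasurableSet[(F t).prod (borel ℝ)] {p : Ω × ℝ | τs p ≤ t}) ∧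
      (∀ f : ℝ → ℝ, ContinuousOn f (Set.Ici 0) →
        (∃ C : ℝ, ∀ x ∈ Set.Ici (0 : ℝ), |f x| ≤ C) →
        ∀ Y : Ω → ℝ, Integrable Y P → StronglyMeasurable[F T] Y →
          Filter.Tendsto
            (fun n => ∫ p, Y p.1 * f (τn (φ n) p.1) ∂(prodLeb P)) Filter.atTop
            (nhds (∫ p, Y p.1 * f (τs p) ∂(prodLeb P)))) := by
  have hgm : ∀ (q : ℚ) n, Measurable[F q] fun ω => (Iic (q : ℝ)).indicator (1 : ℝ → ℝ) (τn n ω) := by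
    intro q n
    have hs : MeasurableSet[F q] {ω | τn n ω ≤ q} := hFn n q _ (hτn n q)
    have : (fun ω => (Iic (q : ℝ)).indicator (1 : ℝ → ℝ) (τn n ω)) =
        {ω | τn n ω ≤ q}.indicator (fun _ => 1) := by
      ext ω
      by_cases h : τn n ω ≤ q <;> simp [h]
    rw [this]
    exact Measurable.indicator measurable_const hs
  obtain ⟨φ, H, hφ, hHm, hH0, hH1, hHmono, hlim⟩ := bc_weak P F hFmono hFle
    (fun q n ω => (Iic (q : ℝ)).indicator (1 : ℝ → ℝ) (τn n ω)) hgm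
    (fun q n ω => indicator_nonneg (fun _ _ => zero_le_one) _)
    (fun q n ω => indicator_le_self' (fun _ _ => zero_le_one) _)
    (fun n ω q r hqr => indicator_le_indicator_of_subset
      (Iic_subset_Iic.2 (by exact_mod_cast hqr)) (fun _ => zero_le_one) _)
  let K : ℝ → Ω → ℝ := fun t ω => ⨅ q : {q : ℚ // t < q}, H q ω
  have hne : ∀ t : ℝ, Nonempty {q : ℚ // t < q} := fun t => by
    obtain ⟨q, hq⟩ := exists_rat_gt t
    exact ⟨⟨q, hq⟩⟩
  have hbdd : ∀ (t : ℝ) ω, BddBelow (range fun q : {q : ℚ // t < q} => H q ω) := fun t ω =>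
    ⟨0, by rintro _ ⟨q, rfl⟩; exact hH0 _ _⟩
  have hHM : ∀ q, Measurable (H q) := fun q => (hHm q).mono (hFle q) le_rfl
  have hKM : ∀ t, Measurable (K t) := fun t => Measurable.iInf fun q => hHM q
  have hKH : ∀ (s : ℝ) (q : ℚ) ω, s < q → K s ω ≤ H q ω := fun s q ω h =>
    ciInf_le (hbdd s ω) (⟨q, h⟩ : {q : ℚ // s < q})
  have hHK : ∀ q : ℚ, ∀ ω, H q ω ≤ K q ω := fun q ω => by
    have := hne q
    exact le_ciInf fun r => hHmono ω (by exact_mod_cast r.2.le)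
  have hK0 : ∀ t ω, 0 ≤ K t ω := fun t ω => Real.iInf_nonneg fun q => hH0 _ _
  have hK1 : ∀ t ω, K t ω ≤ 1 := fun t ω => by
    obtain ⟨q, hq⟩ := exists_rat_gt t
    exact (hKH t q ω hq).trans (hH1 _ _)
  have hKF : ∀ t < T, Measurable[F t] (K t) := by
    intro t ht
    have h1 : ∀ s ∈ Ioc t T, Measurable[F s] (K t) := by
      intro s hs
      have e : K t = fun ω => ⨅ q : {q : ℚ // t < q ∧ (q : ℝ) < s}, H q ω := by
        ext ω
        have := hne t
        have hb' : BddBelow (range fun q : {q : ℚ // t < q ∧ (q : ℝ) < s} => H q ω) :=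
          ⟨0, by rintro _ ⟨q, rfl⟩; exact hH0 _ _⟩
        obtain ⟨r, hr1, hr2⟩ := exists_rat_btwn hs.1
        have : Nonempty {q : ℚ // t < q ∧ (q : ℝ) < s} := ⟨⟨r, hr1, hr2⟩⟩
        apply le_antisymm
        · exact le_ciInf fun q => hKH t q ω q.2.1
        · refine le_ciInf fun q => ?_
          have hm : t < (min (q : ℚ) r : ℚ) ∧ ((min (q : ℚ) r : ℚ) : ℝ) < s := by
            rcases min_choice (q : ℚ) r with h | h
            · refine ⟨by rw [h]; exact q.2, lt_of_le_of_lt ?_ hr2⟩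
              exact_mod_cast min_le_right _ _
            · rw [h]; exact ⟨hr1, hr2⟩
          exact (ciInf_le hb' ⟨_, hm⟩).trans (hHmono ω (min_le_left _ _))
      rw [e]
      exact Measurable.iInf fun q => (hHm q).mono (hFmono q.2.2.le) le_rfl
    intro B hB
    rw [hFrc t ht]
    simp only [MeasurableSpace.measurableSet_iInf]
    exact fun s hs => h1 s hs hB
  let S : Ω × ℝ → Set ℝ := fun p => {t | 0 ≤ t ∧ t < L ∧ p.2 ≤ K t p.1} ∪ {L}
  let X : Ω × ℝ → ℝ := fun p => sInf (S p)
  have hSb : ∀ p, BddBelow (S p) := fun p => ⟨0, by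
    rintro t (h | h)
    · exact h.1
    · rw [mem_singleton_iff.1 h]; exact hL.1⟩
  have hSL : ∀ p, L ∈ S p := fun p => Or.inr rfl
  have hXL : ∀ p, X p ∈ Icc 0 L := fun p => by
    refine ⟨le_csInf ⟨L, hSL p⟩ ?_, csInf_le (hSb p) (hSL p)⟩
    rintro t (h | h)
    · exact h.1
    · rw [mem_singleton_iff.1 h]; exact hL.1
  have hX : ∀ ω v t, X (ω, v) ≤ t ↔ L ≤ t ∨ (0 ≤ t ∧ v ≤ K t ω) := by
    intro ω v t
    constructor
    · intro h
      rcases le_or_gt L t with h1 | h1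
      · exact Or.inl h1
      refine Or.inr ⟨(hXL _).1.trans h, ?_⟩
      have := hne t
      refine le_ciInf fun q => ?_
      have h2 : X (ω, v) < min (q : ℝ) L := h.trans_lt (lt_min q.2 h1)
      obtain ⟨u, hu, hu2⟩ := exists_lt_of_csInf_lt ⟨L, hSL (ω, v)⟩ h2
      rcases hu with hu | hu
      · exact hu.2.2.trans (hKH u q ω (hu2.trans_le (min_le_left _ _)))
      · rw [mem_singleton_iff.1 hu] at hu2
        exact absurd (hu2.trans_le (min_le_right _ _)) (lt_irrefl _)
    · rintro (h | ⟨h0, h⟩)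
      · exact (hXL _).2.trans h
      · rcases le_or_gt L t with h1 | h1
        · exact (hXL _).2.trans h1
        · exact csInf_le (hSb _) (Or.inl ⟨h0, h1, h⟩)
  have hXmeas : ∀ t : ℝ, MeasurableSet[(F t).prod (borel ℝ)] {p : Ω × ℝ | X p ≤ t} := by
    intro t
    rcases le_or_gt L t with h1 | h1
    · have : {p : Ω × ℝ | X p ≤ t} = univ := by
        ext p; simpa using (hXL p).2.trans h1
      rw [this]; exact @MeasurableSet.univ _ ((F t).prod (borel ℝ))
    rcases lt_or_ge t 0 with h0 | h0
    · have : {p : Ω × ℝ | X p ≤ t} = ∅ := by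
        ext p; simpa using h0.trans_le (hXL p).1
      rw [this]; exact @MeasurableSet.empty _ ((F t).prod (borel ℝ))
    have e : {p : Ω × ℝ | X p ≤ t} = {p : Ω × ℝ | p.2 ≤ K t p.1} := by
      ext ⟨ω, v⟩
      simp only [mem_ofPred_eq, hX]
      constructor
      · rintro (h | h)
        · linarith
        · exact h.2
      · exact fun h => Or.inr ⟨h0, h⟩
    rw [e]
    have hK := hKF t (h1.trans_le hL.2)
    rw [← BorelSpace.measurable_eq (α := ℝ)]
    exact bc_meas (F t) (K t) hK
  have hXm : Measurable X := by
    refine measurable_of_Iic fun t => ?_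
    have hle : (F t).prod (borel ℝ) ≤ (inferInstance : MeasurableSpace (Ω × ℝ)) := by
      rw [← BorelSpace.measurable_eq (α := ℝ)]
      exact sup_le_sup (MeasurableSpace.comap_mono (hFle t)) le_rfl
    exact hle _ (hXmeas t)
  refine ⟨X, φ, hφ, hXmeas, ?_⟩
  intro f hf hfb Y hY hYm
  have hτm : ∀ n, Measurable (τn n) := fun n =>
    measurable_of_Iic fun t => hFle t _ (hFn n t _ (hτn n t))
  let f' : ℝ → ℝ := fun x => f (max 0 x)
  have hf' : Continuous f' :=
    hf.comp_continuous (continuous_const.max continuous_id) fun x => mem_Ici.2 (le_max_left _ _)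
  have hff : ∀ x ∈ Icc 0 L, f x = f' x := fun x hx => by simp only [f']; rw [max_eq_right hx.1]
  have hmain : ∀ Y : Ω → ℝ, Integrable Y P → (∀ ω, 0 ≤ Y ω) →
      Tendsto (fun n => ∫ p, Y p.1 * f' (τn (φ n) p.1) ∂(prodLeb P)) atTop
      (𝓝 (∫ p, Y p.1 * f' (X p) ∂(prodLeb P))) := fun Y hY hY0 =>
    bc_main_nonneg P L (fun n => τn (φ n)) (fun n => hτm _) (fun n => hτnL _) H K hHM hKM hH0 hH1
      hK0 hK1 hHK hKH X hXm hXL hX Y hY hY0 (fun q => hlim q Y hY) f' hf'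
  have hYp : Integrable (fun ω => max (Y ω) 0) P := hY.pos_part
  have hYn : Integrable (fun ω => max (-Y ω) 0) P := hY.neg_part
  obtain ⟨C, hC⟩ := hfb
  have hvol : IsProbabilityMeasure ((volume : Measure ℝ).restrict (Icc 0 1)) :=
    ⟨by simp⟩
  have hYZi : ∀ (Z : Ω × ℝ → ℝ) (Y : Ω → ℝ), Measurable Z → Integrable Y P →
      Integrable (fun p : Ω × ℝ => Y p.1 * f' (Z p)) (prodLeb P) := by
    intro Z Y hZ hY
    have hYQ : Integrable (fun p : Ω × ℝ => Y p.1) (prodLeb P) := hY.comp_fst _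
    exact hYQ.mul_bdd (c := C) (hf'.measurable.comp hZ).aestronglyMeasurable
      (Eventually.of_forall fun p => hC _ (mem_Ici.2 (le_max_left _ _)))
  have key : ∀ (Z : Ω × ℝ → ℝ), Measurable Z → (∀ p, Z p ∈ Icc 0 L) →
      ∫ p, Y p.1 * f (Z p) ∂(prodLeb P) = ∫ p, max (Y p.1) 0 * f' (Z p) ∂(prodLeb P) -
        ∫ p, max (-Y p.1) 0 * f' (Z p) ∂(prodLeb P) := by
    intro Z hZ hZL
    rw [← integral_sub (hYZi Z _ hZ hYp) (hYZi Z _ hZ hYn)]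
    refine integral_congr_ae (Eventually.of_forall fun p => ?_)
    simp only
    rw [← sub_mul, hff _ (hZL p)]
    congr 1
    rcases le_total 0 (Y p.1) with h | h
    · rw [max_eq_left h, max_eq_right (by linarith)]; ring
    · rw [max_eq_right h, max_eq_left (by linarith)]; ring
  rw [key X hXm hXL]
  have e : ∀ n, _ := fun n => key (fun p => τn (φ n) p.1) ((hτm _).comp measurable_fst)
    (fun p => hτnL _ _)
  simp only [e]
  exact (hmain _ hYp fun ω => le_max_right _ _).sub (hmain _ hYn fun ω => le_max_right _ _)
end

section
/- Let X be a càdlàg process and ℱ the right-continuous filtration associated to its natural filtration. Then Γ*(L) = Γ(L), where Γ(L) = sup{E[γ(τ, X_τ)] : τ an ℱ-stopping time with τ ≤ L} and Γ*(L) = sup{E_{P⊗μ}[γ(τ*(ω,v), X_{τ*(ω,v)}(ω))] : τ* a randomized ℱ-stopping time with τ* ≤ L}. -/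
open MeasureTheory Filter Set Topology

lemma natFilt_le_amb {Ω : Type*} [m : MeasurableSpace Ω] (X : ℝ → Ω → ℝ)
    (hXm : ∀ s : ℝ, Measurable (X s)) (t : ℝ) : natFilt X t ≤ m := by
  refine iSup₂_le fun s _ => ?_
  have h := (hXm s).comap_le
  rwa [BorelSpace.measurable_eq (α := ℝ)] at h

lemma rcFilt_le_amb {Ω : Type*} [m : MeasurableSpace Ω] (X : ℝ → Ω → ℝ)
    (hXm : ∀ s : ℝ, Measurable (X s)) (T t : ℝ) : rcFilt X T t ≤ m := by
  unfold rcFilt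
  split_ifs with h
  · exact (iInf₂_le T ⟨h, le_rfl⟩).trans (natFilt_le_amb X hXm T)
  · exact natFilt_le_amb X hXm T

/-- A càdlàg process evaluated at a measurable random time is measurable. -/
lemma measurable_eval_cadlag {Ω S : Type*} [MeasurableSpace Ω] [MeasurableSpace S]
    (X : ℝ → Ω → ℝ) (hXm : ∀ s : ℝ, Measurable (X s)) (T : ℝ)
    (hXcad : ∀ ω, IsCadlagOn T (fun t => X t ω))
    (σ : S → ℝ) (hσ : Measurable σ) (hσT : ∀ p, σ p ∈ Set.Icc 0 T)
    (π : S → Ω) (hπ : Measurable π) :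
    Measurable (fun p => X (σ p) (π p)) := by
  let r : ℕ → ℝ → ℝ := fun n t => min (((⌊((n : ℝ) + 1) * t⌋ : ℝ) + 1) / ((n : ℝ) + 1)) T
  refine measurable_of_tendsto_metrizable (f := fun n p => X (r n (σ p)) (π p)) ?_ ?_
  · intro n
    have h1 : Measurable (fun q : ℤ × Ω =>
        X (min (((q.1 : ℝ) + 1) / ((n : ℝ) + 1)) T) q.2) :=
      measurable_from_prod_countable_right fun k => hXm (min (((k : ℝ) + 1) / ((n : ℝ) + 1)) T)
    have h2 : Measurable (fun p => (⌊((n : ℝ) + 1) * σ p⌋, π p)) :=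
      (Int.measurable_floor.comp (hσ.const_mul _)).prodMk hπ
    exact h1.comp h2
  · rw [tendsto_pi_nhds]
    intro p
    rcases (hσT p).2.lt_or_eq with hlt | heq
    · have hgt : ∀ n, σ p < r n (σ p) := by
        intro n
        refine lt_min ?_ hlt
        rw [lt_div_iff₀ (by positivity)]
        have := Int.lt_floor_add_one (((n : ℝ) + 1) * σ p)
        linarith
      have hle : ∀ n, r n (σ p) ≤ σ p + 1 / ((n : ℝ) + 1) := by
        intro n
        refine (min_le_left _ _).trans ?_
        have hn : (0 : ℝ) < (n : ℝ) + 1 := by positivity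
        have h3 : (σ p + 1 / ((n : ℝ) + 1)) * ((n : ℝ) + 1) = ((n : ℝ) + 1) * σ p + 1 := by
          field_simp
        rw [div_le_iff₀ hn, h3]
        have := Int.floor_le (((n : ℝ) + 1) * σ p)
        linarith
      have hlim : Tendsto (fun n => r n (σ p)) atTop (𝓝 (σ p)) := by
        refine tendsto_of_tendsto_of_tendsto_of_le_of_le tendsto_const_nhds ?_
          (fun n => (hgt n).le) hle
        simpa using (tendsto_one_div_add_atTop_nhds_zero_nat (𝕜 := ℝ)).const_add (σ p)
      have hlim2 : Tendsto (fun n => r n (σ p)) atTop (𝓝[>] (σ p)) :=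
        tendsto_nhdsWithin_iff.2 ⟨hlim, Eventually.of_forall hgt⟩
      exact ((hXcad (π p)).1 (σ p) ⟨(hσT p).1, hlt⟩).comp hlim2
    · have : ∀ n, r n (σ p) = σ p := by
        intro n
        have hn : (0 : ℝ) < (n : ℝ) + 1 := by positivity
        have h2 : σ p ≤ ((⌊((n : ℝ) + 1) * σ p⌋ : ℝ) + 1) / ((n : ℝ) + 1) := by
          rw [le_div_iff₀ hn]
          have := Int.lt_floor_add_one (((n : ℝ) + 1) * σ p)
          linarith
        show min _ T = _
        rw [min_eq_right (heq ▸ h2), heq]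
      simp only [this]
      exact tendsto_const_nhds

/-- (Lemma `Γ* = Γ`.) The value in optimal stopping over
randomized `ℱ`-stopping times bounded by `L` equals the value over ordinary
`ℱ`-stopping times bounded by `L`. -/
theorem randomized_value_eq_value
    {Ω : Type*} [MeasurableSpace Ω] (P : Measure Ω) [IsProbabilityMeasure P]
    (T L : ℝ) (hT : 0 < T) (hL : L ∈ Set.Icc 0 T)
    (γ : ℝ → ℝ → ℝ)
    (hγc : ContinuousOn (fun p : ℝ × ℝ => γ p.1 p.2) (Set.Ici 0 ×ˢ Set.univ))
    (hγb : ∃ C : ℝ, ∀ t ∈ Set.Ici (0 : ℝ), ∀ y : ℝ, |γ t y| ≤ C)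
    (X : ℝ → Ω → ℝ) (hXm : ∀ s : ℝ, Measurable (X s))
    (hXcad : ∀ ω, IsCadlagOn T (fun t => X t ω)) :
    sSup {x | ∃ τs : Ω × ℝ → ℝ,
        (∀ t : ℝ, MeasurableSet[(rcFilt X T t).prod (borel ℝ)] {p : Ω × ℝ | τs p ≤ t}) ∧
        (∀ ω : Ω, ∀ v ∈ Set.Icc (0 : ℝ) 1, τs (ω, v) ∈ Set.Icc 0 L) ∧
        x = ∫ p, γ (τs p) (X (τs p) p.1) ∂(prodLeb P)}
      = optValue P (rcFilt X T) X γ L := by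
  obtain ⟨C, hC⟩ := hγb
  have hνprob : IsProbabilityMeasure ((volume : Measure ℝ).restrict (Set.Icc 0 1)) :=
    ⟨by simp⟩
  have hbdd : BddAbove {x | ∃ τ : Ω → ℝ, IsStoppingTimeOn (rcFilt X T) τ ∧
      (∀ ω, τ ω ∈ Set.Icc 0 L) ∧ x = ∫ ω, γ (τ ω) (X (τ ω) ω) ∂P} := by
    refine ⟨C, ?_⟩
    rintro x ⟨τ, _, h2, rfl⟩
    have := norm_integral_le_of_norm_le_const (μ := P)
      (f := fun ω => γ (τ ω) (X (τ ω) ω)) (C := C)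
      (Eventually.of_forall fun ω => hC _ (h2 ω).1 _)
    simp at this
    exact (le_abs_self _).trans this
  have hle : ∀ x, (∃ τs : Ω × ℝ → ℝ,
        (∀ t : ℝ, MeasurableSet[(rcFilt X T t).prod (borel ℝ)] {p : Ω × ℝ | τs p ≤ t}) ∧
        (∀ ω : Ω, ∀ v ∈ Set.Icc (0 : ℝ) 1, τs (ω, v) ∈ Set.Icc 0 L) ∧
        x = ∫ p, γ (τs p) (X (τs p) p.1) ∂(prodLeb P)) →
      x ≤ optValue P (rcFilt X T) X γ L := by
    rintro x ⟨τs, h1, h2, rfl⟩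
    -- the randomized time is measurable, and so is the clipped version
    have hτm : Measurable τs := by
      refine measurable_of_Iic fun t => ?_
      have hle : (rcFilt X T t).prod (borel ℝ) ≤
          (inferInstance : MeasurableSpace (Ω × ℝ)) := by
        refine sup_le_sup (MeasurableSpace.comap_mono (rcFilt_le_amb X hXm T t)) ?_
        rw [BorelSpace.measurable_eq (α := ℝ)]
      exact hle _ (h1 t)
    let σ : Ω × ℝ → ℝ := fun p => max 0 (min (τs p) L)
    have hσm : Measurable σ := measurable_const.max (hτm.min measurable_const)
    have hσ0 : ∀ p, σ p ∈ Set.Icc 0 T := fun p =>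
      ⟨le_max_left _ _, max_le hT.le ((min_le_right _ _).trans hL.2)⟩
    have hστ : ∀ ω : Ω, ∀ v ∈ Set.Icc (0 : ℝ) 1, σ (ω, v) = τs (ω, v) := by
      intro ω v hv
      have := h2 ω v hv
      show max 0 (min _ L) = _
      rw [min_eq_left this.2, max_eq_right this.1]
    have hXσ : Measurable (fun p : Ω × ℝ => X (σ p) p.1) :=
      measurable_eval_cadlag X hXm T hXcad σ hσm hσ0 Prod.fst measurable_fst
    let G : Ω × ℝ → ℝ := fun p => γ (σ p) (X (σ p) p.1)
    have hGm : Measurable G := by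
      have hc : Continuous (fun q : ℝ × ℝ => γ (max 0 q.1) q.2) :=
        hγc.comp_continuous (f := fun q : ℝ × ℝ => (max 0 q.1, q.2)) (by fun_prop)
          (fun q => ⟨le_max_left (0 : ℝ) q.1, mem_univ _⟩)
      have h3 := hc.measurable.comp (hσm.prodMk hXσ)
      have h4 : G = (fun q : ℝ × ℝ => γ (max 0 q.1) q.2) ∘
          (fun p => (σ p, X (σ p) p.1)) := by
        funext p
        simp only [Function.comp, G, max_eq_right (hσ0 p).1]
      rw [h4]; exact h3
    have hGi : Integrable G (P.prod ((volume : Measure ℝ).restrict (Set.Icc 0 1))) :=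
      Integrable.of_bound hGm.aestronglyMeasurable C
        (Eventually.of_forall fun p => hC _ (hσ0 p).1 _)
    have hae : ∀ᵐ p ∂(P.prod ((volume : Measure ℝ).restrict (Set.Icc 0 1))),
        p.2 ∈ Set.Icc (0 : ℝ) 1 :=
      Measure.quasiMeasurePreserving_snd.ae (ae_restrict_mem measurableSet_Icc)
    have hint : ∫ p, γ (τs p) (X (τs p) p.1) ∂(prodLeb P)
        = ∫ p, G p ∂(P.prod ((volume : Measure ℝ).restrict (Set.Icc 0 1))) := by
      refine integral_congr_ae ?_
      filter_upwards [hae] with p hp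
      have := hστ p.1 p.2 hp
      simp only [Prod.mk.eta] at this
      simp only [G, this]
    rw [hint, integral_prod_symm _ hGi]
    calc ∫ v in Set.Icc (0 : ℝ) 1, ∫ ω, G (ω, v) ∂P
        ≤ ∫ v in Set.Icc (0 : ℝ) 1, optValue P (rcFilt X T) X γ L := by
          refine integral_mono_ae hGi.integral_prod_right (integrable_const _) ?_
          filter_upwards [ae_restrict_mem measurableSet_Icc] with v hv
          refine le_csSup hbdd ⟨fun ω => τs (ω, v), ?_, fun ω => h2 ω v hv, ?_⟩
          · intro t
            have hm : @Measurable Ω (Ω × ℝ) (rcFilt X T t)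
                ((rcFilt X T t).prod (borel ℝ)) (fun ω => (ω, v)) := by
              letI : MeasurableSpace Ω := rcFilt X T t
              rw [← BorelSpace.measurable_eq (α := ℝ)]
              exact measurable_prodMk_right
            exact hm (h1 t)
          · refine integral_congr_ae (Eventually.of_forall fun ω => ?_)
            simp only [G, hστ ω v hv]
      _ = optValue P (rcFilt X T) X γ L := by simp
  refine le_antisymm (csSup_le ?_ hle) (csSup_le ?_ ?_)
  · exact ⟨_, fun _ => 0, fun t => MeasurableSet.const _, fun _ _ _ => ⟨le_rfl, hL.1⟩, rfl⟩
  · exact ⟨_, fun _ => 0, fun t => MeasurableSet.const _, fun _ => ⟨le_rfl, hL.1⟩, rfl⟩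
  · rintro x ⟨τ, h1, h2, rfl⟩
    refine le_csSup ⟨_, hle⟩ ⟨fun p => τ p.1, ?_, fun ω v _ => h2 ω, ?_⟩
    · intro t
      have hm : @Measurable (Ω × ℝ) Ω ((rcFilt X T t).prod (borel ℝ)) (rcFilt X T t)
          Prod.fst := by
        letI : MeasurableSpace Ω := rcFilt X T t
        rw [← BorelSpace.measurable_eq (α := ℝ)]
        exact measurable_fst
      exact hm (h1 t)
    · unfold prodLeb
      rw [integral_fun_fst (fun ω => γ (τ ω) (X (τ ω) ω))]
      simp
end

section
/- Let (Xⁿ) be a sequence of càdlàg processes converging in probability for the Skorokhod topology to a càdlàg process X, with ℱⁿ the natural filtrations of the Xⁿ. Let (τ^{*,n}) be randomized ℱⁿ-stopping times bounded by L converging in the sense of Baxter and Chacon to a measurable map τ* : Ω × [0,1] → [0,L]. Then for every k, all t₁ < … < t_k in [0,T] with P[ΔX_{t_i} ≠ 0] = 0 for each i, and every bounded continuous φ : ℝᵏ × ℝ → ℝ, one has ∫ φ(Xⁿ_{t₁}(ω), …, Xⁿ_{t_k}(ω), τ^{*,n}(ω,v)) d(P⊗μ)(ω,v) → ∫ φ(X_{t₁}(ω),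 …, X_{t_k}(ω), τ*(ω,v)) d(P⊗μ)(ω,v); that is, the finite-dimensional laws of (Xⁿ, τ^{*,n}) converge weakly to those of (X, τ*). -/
open MeasureTheory Filter Set Topology

open scoped unitInterval

/-- Continuity at a point with no jump, within `[0,T]`. -/
lemma aux_cont {T : ℝ} {f : ℝ → ℝ} (hf : IsCadlagOn T f) {t : ℝ} (ht : t ∈ Set.Ioo (0 : ℝ) T)
    (hj : pathJump f t = 0) : ContinuousAt f t := by
  obtain ⟨l, hl⟩ := hf.2 t ⟨ht.1, ht.2.le⟩
  have h1 : Function.leftLim f t = l := leftLim_eq_of_tendsto hl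
  have h2 : f t = l := by
    have := hj
    unfold pathJump at this
    linarith
  rw [continuousAt_iff_continuous_left'_right']
  refine ⟨?_, hf.1 t ⟨ht.1.le, ht.2⟩⟩
  unfold ContinuousWithinAt
  rw [h2]; exact hl

/-- Extraction of an almost surely convergent subsequence. -/
lemma aux_subseq {Ω : Type*} [MeasurableSpace Ω] (P : Measure Ω)
    (T : ℝ) (hT : 0 < T) (X : ℝ → Ω → ℝ) (Xn : ℕ → ℝ → Ω → ℝ)
    (hXcad : ∀ ω, IsCadlagOn T (fun t => X t ω))
    (hconv : SkorokhodTendstoP P T Xn X) (ns : ℕ → ℕ) (hns : Tendsto ns atTop atTop) :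
    ∃ ms : ℕ → ℕ, Tendsto (fun j => ns (ms j)) atTop atTop ∧
      ∀ᵐ ω ∂P, ∀ t ∈ Set.Icc (0 : ℝ) T, pathJump (fun r => X r ω) t = 0 →
        Tendsto (fun j => Xn (ns (ms j)) t ω) atTop (𝓝 (X t ω)) := by
  obtain ⟨Λ, hc, hm, h0, h1, hmaps, hA, hB⟩ := hconv
  have key : ∀ j : ℕ, ∃ m : ℕ, j ≤ m ∧
      P {ω | ∃ t ∈ Set.Icc (0 : ℝ) T, 1 / ((j : ℝ) + 1) ≤
        |Xn (ns m) (Λ (ns m) ω t) ω - X t ω|} < (2⁻¹ : ENNReal) ^ j ∧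
      P {ω | ∃ t ∈ Set.Icc (0 : ℝ) T, 1 / ((j : ℝ) + 1) ≤ |Λ (ns m) ω t - t|}
        < (2⁻¹ : ENNReal) ^ j := by
    intro j
    have hε : (0 : ℝ) < 1 / ((j : ℝ) + 1) := by positivity
    have hpos : (0 : ENNReal) < (2⁻¹ : ENNReal) ^ j := ENNReal.pow_pos (by simp) j
    have a := ((hA _ hε).comp hns).eventually (gt_mem_nhds hpos)
    have b := ((hB _ hε).comp hns).eventually (gt_mem_nhds hpos)
    obtain ⟨m, ⟨hm1, hm2⟩, hm3⟩ := ((a.and b).and (eventually_ge_atTop j)).exists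
    exact ⟨m, hm3, hm1, hm2⟩
  choose ms hge hPA hPB using key
  have hms : Tendsto ms atTop atTop := tendsto_atTop_mono hge tendsto_id
  refine ⟨ms, hns.comp hms, ?_⟩
  have hsum : ∑' j : ℕ, (2⁻¹ : ENNReal) ^ j ≠ ⊤ := by
    rw [ENNReal.tsum_geometric]; simp
  have eA := ae_eventually_notMem (ne_top_of_le_ne_top hsum (ENNReal.tsum_le_tsum fun j => (hPA j).le))
  have eB := ae_eventually_notMem (ne_top_of_le_ne_top hsum (ENNReal.tsum_le_tsum fun j => (hPB j).le))
  filter_upwards [eA, eB] with ω ha hb t ht hj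
  simp only [not_exists, not_and, not_le] at ha hb
  have hs : ∀ j, ∃ s ∈ Set.Icc (0 : ℝ) T, Λ (ns (ms j)) ω s = t ∧
      (t = 0 → s = 0) ∧ (t = T → s = T) := by
    intro j
    by_cases ht0 : t = 0
    · exact ⟨0, ⟨le_rfl, hT.le⟩, by rw [h0, ht0], fun _ => rfl, fun h => by linarith⟩
    by_cases htT : t = T
    · exact ⟨T, ⟨hT.le, le_rfl⟩, by rw [h1, htT], fun h => absurd h ht0, fun _ => rfl⟩
    have := intermediate_value_Icc hT.le (hc (ns (ms j)) ω)
    rw [h0, h1] at this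
    obtain ⟨s, hs, hst⟩ := this ht
    exact ⟨s, hs, hst, fun h => absurd h ht0, fun h => absurd h htT⟩
  choose s hsI hst hs0 hsT using hs
  have hlim := tendsto_one_div_add_atTop_nhds_zero_nat (𝕜 := ℝ)
  have hsl : Tendsto s atTop (𝓝 t) := by
    rw [tendsto_iff_norm_sub_tendsto_zero]
    refine squeeze_zero' (Eventually.of_forall fun _ => norm_nonneg _) ?_ hlim
    filter_upwards [hb] with j hj
    have := hj (s j) (hsI j)
    rw [hst] at this
    rw [Real.norm_eq_abs, abs_sub_comm]; exact this.le
  have hXs : Tendsto (fun j => X (s j) ω) atTop (𝓝 (X t ω)) := by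
    by_cases ht0 : t = 0
    · have : s = fun _ => t := by ext j; rw [hs0 j ht0, ht0]
      rw [this]; exact tendsto_const_nhds
    by_cases htT : t = T
    · have : s = fun _ => t := by ext j; rw [hsT j htT, htT]
      rw [this]; exact tendsto_const_nhds
    have := aux_cont (hXcad ω) ⟨lt_of_le_of_ne ht.1 (Ne.symm ht0), lt_of_le_of_ne ht.2 htT⟩ hj
    exact this.tendsto.comp hsl
  have hd : Tendsto (fun j => Xn (ns (ms j)) t ω - X (s j) ω) atTop (𝓝 0) := by
    rw [tendsto_zero_iff_norm_tendsto_zero]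
    refine squeeze_zero' (Eventually.of_forall fun _ => norm_nonneg _) ?_ hlim
    filter_upwards [ha] with j hj
    have := hj (s j) (hsI j)
    rw [hst] at this
    exact this.le
  simpa using hd.add hXs

lemma aux_prob {Ω : Type*} [MeasurableSpace Ω] (P : Measure Ω) [IsProbabilityMeasure P] :
    IsProbabilityMeasure (prodLeb P) := by
  have : IsProbabilityMeasure ((volume : Measure ℝ).restrict (Set.Icc 0 1)) := ⟨by simp⟩
  unfold prodLeb
  infer_instance

lemma aux_meas {Ω : Type*} [MeasurableSpace Ω] {k : ℕ} (F : C(Fin k → ℝ, C(I, ℝ)))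
    (g : C(ℝ, I)) {Z : Ω → Fin k → ℝ} (hZ : Measurable Z) {τ : Ω × ℝ → ℝ} (hτ : Measurable τ) :
    Measurable (fun p : Ω × ℝ => F (Z p.1) (g (τ p))) := by
  have hc : Continuous (fun q : (Fin k → ℝ) × ℝ => F q.1 (g q.2)) := by fun_prop
  exact hc.measurable.comp ((hZ.comp measurable_fst).prodMk hτ)

/-- Stable convergence. -/
lemma aux_stable {Ω : Type*} [MeasurableSpace Ω] (P : Measure Ω) [IsProbabilityMeasure P]
    {k : ℕ} (F : C(Fin k → ℝ, C(I, ℝ))) (C : ℝ) (hF : ∀ x, ‖F x‖ ≤ C) (g : C(ℝ, I))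
    (Z : Ω → Fin k → ℝ) (hZ : Measurable Z)
    (τsn : ℕ → Ω × ℝ → ℝ) (hτsn : ∀ n, Measurable (τsn n))
    (τs : Ω × ℝ → ℝ) (hτs : Measurable τs)
    (hBC : ∀ f : ℝ → ℝ, ContinuousOn f (Set.Ici 0) →
      (∃ C : ℝ, ∀ x ∈ Set.Ici (0 : ℝ), |f x| ≤ C) →
      ∀ Y : Ω → ℝ, Integrable Y P →
        Filter.Tendsto (fun n => ∫ p, Y p.1 * f (τsn n p) ∂(prodLeb P)) Filter.atTop
          (nhds (∫ p, Y p.1 * f (τs p) ∂(prodLeb P)))) :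
    Tendsto (fun n => ∫ p, F (Z p.1) (g (τsn n p)) ∂(prodLeb P)) atTop
      (𝓝 (∫ p, F (Z p.1) (g (τs p)) ∂(prodLeb P))) := by
  have hQ := aux_prob P
  -- the approximating functions
  let B : ℕ → C(Fin k → ℝ, C(I, ℝ)) := fun N =>
    ⟨fun x => bernsteinApproximation N (F x), by
      unfold bernsteinApproximation
      refine continuous_finsetSum _ fun j _ => ?_
      refine ContinuousMap.continuous_of_continuous_uncurry _ ?_
      simp only [Function.uncurry_def, ContinuousMap.smul_apply', ContinuousMap.const_apply]
      fun_prop⟩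
  have hBapp : ∀ N x s, B N x s = ∑ j : Fin (N + 1), bernstein N j s * F x (bernstein.z j) := by
    intro N x s
    simp [B, bernsteinApproximation.apply]
  have hBb : ∀ N x s, |B N x s| ≤ C := by
    intro N x s
    rw [hBapp]
    calc _ ≤ ∑ j : Fin (N + 1), |bernstein N j s * F x (bernstein.z j)| :=
          Finset.abs_sum_le_sum_abs _ _
      _ ≤ ∑ j : Fin (N + 1), bernstein N j s * C := by
          refine Finset.sum_le_sum fun j _ => ?_
          rw [abs_mul, abs_of_nonneg bernstein_nonneg]
          exact mul_le_mul_of_nonneg_left (((F x).norm_coe_le_norm _).trans (hF x))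
            bernstein_nonneg
      _ = C := by rw [← Finset.sum_mul, bernstein.probability, one_mul]
  have hFb : ∀ x s, |F x s| ≤ C := fun x s => ((F x).norm_coe_le_norm s).trans (hF x)
  have hC : 0 ≤ C := (norm_nonneg _).trans (hF 0)
  have hint : ∀ (G : C(Fin k → ℝ, C(I, ℝ))), (∀ x s, |G x s| ≤ C) → ∀ τ : Ω × ℝ → ℝ,
      Measurable τ → Integrable (fun p : Ω × ℝ => G (Z p.1) (g (τ p))) (prodLeb P) := by
    intro G hG τ hτ
    exact Integrable.of_bound (aux_meas G g hZ hτ).aestronglyMeasurable C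
      (Eventually.of_forall fun p => hG _ _)
  -- convergence for the approximations
  have hBconv : ∀ N, Tendsto (fun n => ∫ p, B N (Z p.1) (g (τsn n p)) ∂(prodLeb P)) atTop
      (𝓝 (∫ p, B N (Z p.1) (g (τs p)) ∂(prodLeb P))) := by
    intro N
    have hY : ∀ j : Fin (N + 1), Measurable fun ω => F (Z ω) (bernstein.z j) := fun j => by
      have : Continuous fun x => F x (bernstein.z j) := by fun_prop
      exact this.measurable.comp hZ
    have hf : ∀ j : Fin (N + 1), Continuous fun u => bernstein N j (g u) := fun j => by fun_prop
    have hfb : ∀ (j : Fin (N + 1)) (u : ℝ), |bernstein N j (g u)| ≤ ‖bernstein N j‖ := fun j u =>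
      (bernstein N j).norm_coe_le_norm _
    have hrw : ∀ τ : Ω × ℝ → ℝ, Measurable τ → ∫ p, B N (Z p.1) (g (τ p)) ∂(prodLeb P) =
        ∑ j : Fin (N + 1), ∫ p, F (Z p.1) (bernstein.z j) * bernstein N j (g (τ p))
          ∂(prodLeb P) := by
      intro τ hτ
      rw [← integral_finsetSum]
      · refine integral_congr_ae (Eventually.of_forall fun p => ?_)
        simp only [hBapp]
        exact Finset.sum_congr rfl fun j _ => mul_comm _ _
      · intro j _
        refine Integrable.of_bound (C := C * ‖bernstein N j‖) ?_ (Eventually.of_forall fun p => ?_)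
        · exact (((hY j).comp measurable_fst).mul
            ((hf j).measurable.comp hτ)).aestronglyMeasurable
        · rw [norm_mul]
          exact mul_le_mul (hFb _ _) (hfb _ _) (norm_nonneg _) hC
    rw [hrw τs hτs]
    simp_rw [fun n => hrw (τsn n) (hτsn n)]
    refine tendsto_finsetSum _ fun j _ => ?_
    refine hBC (fun u => bernstein N j (g u)) (hf j).continuousOn ⟨_, fun u _ => hfb j u⟩
      (fun ω => F (Z ω) (bernstein.z j)) ?_
    exact Integrable.of_bound (hY j).aestronglyMeasurable C (Eventually.of_forall fun p => hFb _ _)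
  -- the error
  let D : ℕ → (Fin k → ℝ) → ℝ := fun N x => ‖B N x - F x‖
  have hDm : ∀ N, Measurable fun p : Ω × ℝ => D N (Z p.1) := fun N => by
    have : Continuous (D N) := by
      have h1 := (B N).continuous
      have h2 := F.continuous
      exact (h1.sub h2).norm
    exact this.measurable.comp (hZ.comp measurable_fst)
  have hDb : ∀ N x, ‖D N x‖ ≤ C + C := by
    intro N x
    rw [norm_norm]
    refine (norm_sub_le _ _).trans (add_le_add ?_ (hF x))
    rw [ContinuousMap.norm_le _ hC]
    exact hBb N x
  have hDi : ∀ N, Integrable (fun p : Ω × ℝ => D N (Z p.1)) (prodLeb P) := fun N =>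
    Integrable.of_bound (hDm N).aestronglyMeasurable (C + C) (Eventually.of_forall fun p => hDb _ _)
  have hDlim : Tendsto (fun N => ∫ p, D N (Z p.1) ∂(prodLeb P)) atTop (𝓝 0) := by
    have := tendsto_integral_of_dominated_convergence (μ := prodLeb P)
      (F := fun N p => D N (Z p.1)) (f := fun _ => (0 : ℝ)) (fun _ => C + C)
      (fun N => (hDm N).aestronglyMeasurable) (integrable_const _)
      (fun N => Eventually.of_forall fun p => hDb _ _)
      (Eventually.of_forall fun p => by
        have := bernsteinApproximation_uniform (F (Z p.1))
        exact tendsto_iff_norm_sub_tendsto_zero.1 this)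
    simpa using this
  have herr : ∀ N, ∀ τ : Ω × ℝ → ℝ, Measurable τ →
      |∫ p, B N (Z p.1) (g (τ p)) ∂(prodLeb P) - ∫ p, F (Z p.1) (g (τ p)) ∂(prodLeb P)|
        ≤ ∫ p, D N (Z p.1) ∂(prodLeb P) := by
    intro N τ hτ
    rw [← integral_sub (hint _ (hBb N) τ hτ) (hint _ hFb τ hτ)]
    rw [← Real.norm_eq_abs]
    refine norm_integral_le_of_norm_le (hDi N) (Eventually.of_forall fun p => ?_)
    exact (B N (Z p.1) - F (Z p.1)).norm_coe_le_norm _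
  rw [Metric.tendsto_atTop]
  intro ε hε
  obtain ⟨N, hN⟩ := (hDlim.eventually (gt_mem_nhds (show (0 : ℝ) < ε / 3 by positivity))).exists
  obtain ⟨n0, hn0⟩ := (Metric.tendsto_atTop.1 (hBconv N)) (ε / 3) (by positivity)
  refine ⟨n0, fun n hn => ?_⟩
  have e1 := abs_le.1 (herr N (τsn n) (hτsn n))
  have e2 := abs_le.1 (herr N τs hτs)
  have e3 := hn0 n hn
  rw [Real.dist_eq] at e3 ⊢
  have e3 := abs_lt.1 e3
  rw [abs_lt]
  constructor <;> linarith [e1.1, e1.2, e2.1, e2.2, e3.1, e3.2]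

/-- (Proposition `cvcouple`, finite-dimensional form.) If
`Xⁿ →P X` (Skorokhod) and the randomized `ℱⁿ`-stopping times `τ^{*,n}` converge in
the sense of Baxter and Chacon to `τ*`, then the finite-dimensional laws of
`(Xⁿ, τ^{*,n})` converge weakly to those of `(X, τ*)`. -/
theorem joint_fidi_convergence_with_randomized_times
    {Ω : Type*} [MeasurableSpace Ω] (P : Measure Ω) [IsProbabilityMeasure P]
    (T L : ℝ) (hT : 0 < T) (hL : L ∈ Set.Icc 0 T)
    (X : ℝ → Ω → ℝ) (Xn : ℕ → ℝ → Ω → ℝ)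
    (hXm : ∀ s : ℝ, Measurable (X s)) (hXnm : ∀ n, ∀ s : ℝ, Measurable (Xn n s))
    (hXcad : ∀ ω, IsCadlagOn T (fun t => X t ω))
    (hXncad : ∀ n ω, IsCadlagOn T (fun t => Xn n t ω))
    (hconv : SkorokhodTendstoP P T Xn X)
    (τsn : ℕ → Ω × ℝ → ℝ)
    (hτsn : ∀ n, ∀ t : ℝ,
      MeasurableSet[(natFilt (Xn n) t).prod (borel ℝ)] {p : Ω × ℝ | τsn n p ≤ t})
    (hτsnL : ∀ n, ∀ ω : Ω, ∀ v ∈ Set.Icc (0 : ℝ) 1, τsn n (ω, v) ∈ Set.Icc 0 L)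
    (τs : Ω × ℝ → ℝ) (hτs : Measurable τs)
    (hτsL : ∀ ω : Ω, ∀ v ∈ Set.Icc (0 : ℝ) 1, τs (ω, v) ∈ Set.Icc 0 L)
    (hBC : ∀ f : ℝ → ℝ, ContinuousOn f (Set.Ici 0) →
      (∃ C : ℝ, ∀ x ∈ Set.Ici (0 : ℝ), |f x| ≤ C) →
      ∀ Y : Ω → ℝ, Integrable Y P →
        Filter.Tendsto (fun n => ∫ p, Y p.1 * f (τsn n p) ∂(prodLeb P)) Filter.atTop
          (nhds (∫ p, Y p.1 * f (τs p) ∂(prodLeb P)))) :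
    ∀ k : ℕ, ∀ ts : Fin k → ℝ, StrictMono ts → (∀ i, ts i ∈ Set.Icc (0 : ℝ) T) →
      (∀ i, P {ω | pathJump (fun r => X r ω) (ts i) ≠ 0} = 0) →
      ∀ φ : (Fin k → ℝ) → ℝ → ℝ,
        Continuous (fun q : (Fin k → ℝ) × ℝ => φ q.1 q.2) →
        (∃ C : ℝ, ∀ v u, |φ v u| ≤ C) →
        Filter.Tendsto
          (fun n => ∫ p, φ (fun i => Xn n (ts i) p.1) (τsn n p) ∂(prodLeb P))
          Filter.atTop
          (nhds (∫ p, φ (fun i => X (ts i) p.1) (τs p) ∂(prodLeb P))) := by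
  intro k ts _ hts hjump φ hφ ⟨C, hC⟩
  have hQ := aux_prob P
  have hτm : ∀ n, Measurable (τsn n) := by
    intro n
    refine measurable_of_Iic fun t => ?_
    have hle : natFilt (Xn n) t ≤ (inferInstance : MeasurableSpace Ω) := by
      unfold natFilt
      refine iSup₂_le fun s _ => ?_
      rw [← BorelSpace.measurable_eq (α := ℝ)]
      exact (hXnm n s).comap_le
    have hle2 : (natFilt (Xn n) t).prod (borel ℝ) ≤ (inferInstance : MeasurableSpace (Ω × ℝ)) := by
      rw [← BorelSpace.measurable_eq (α := ℝ)]
      exact sup_le_sup (MeasurableSpace.comap_mono hle) le_rfl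
    exact hle2 _ (hτsn n t)
  let g : C(ℝ, I) := ⟨fun u => Set.projIcc 0 1 zero_le_one (u / T), by
    exact continuous_projIcc.comp (by fun_prop)⟩
  let F : C(Fin k → ℝ, C(I, ℝ)) :=
    ContinuousMap.curry ⟨fun q => φ q.1 (T * q.2), by
      exact hφ.comp (by fun_prop : Continuous fun q : (Fin k → ℝ) × I => (q.1, T * (q.2 : ℝ)))⟩
  have hF : ∀ x, ‖F x‖ ≤ C := fun x =>
    (ContinuousMap.norm_le _ ((abs_nonneg _).trans (hC 0 0))).2 fun s => hC _ _
  have hFg : ∀ x, ∀ u ∈ Set.Icc 0 L, φ x u = F x (g u) := by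
    intro x u hu
    have h1 : u / T ∈ Set.Icc (0 : ℝ) 1 :=
      ⟨div_nonneg hu.1 hT.le, (div_le_one hT).2 (hu.2.trans hL.2)⟩
    change φ x u = φ x (T * (Set.projIcc (0 : ℝ) 1 zero_le_one (u / T) : I))
    rw [Set.projIcc_of_mem _ h1]
    congr 1
    field_simp
  have hae : ∀ᵐ p ∂(prodLeb P), p.2 ∈ Set.Icc (0 : ℝ) 1 := by
    unfold prodLeb
    exact Measure.quasiMeasurePreserving_snd.ae (ae_restrict_mem measurableSet_Icc)
  have hrw : ∀ (Z : Ω → Fin k → ℝ) (τ : Ω × ℝ → ℝ),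
      (∀ ω : Ω, ∀ v ∈ Set.Icc (0 : ℝ) 1, τ (ω, v) ∈ Set.Icc 0 L) →
      ∫ p, φ (Z p.1) (τ p) ∂(prodLeb P) = ∫ p, F (Z p.1) (g (τ p)) ∂(prodLeb P) := by
    intro Z τ hτ
    refine integral_congr_ae ?_
    filter_upwards [hae] with p hp
    exact hFg _ _ (hτ p.1 p.2 hp)
  let Z : Ω → Fin k → ℝ := fun ω i => X (ts i) ω
  let Zn : ℕ → Ω → Fin k → ℝ := fun n ω i => Xn n (ts i) ω
  have hZ : Measurable Z := measurable_pi_lambda _ fun i => hXm _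
  have hZn : ∀ n, Measurable (Zn n) := fun n => measurable_pi_lambda _ fun i => hXnm _ _
  have hst := aux_stable P F C hF g Z hZ τsn hτm τs hτs hBC
  have e1 : ∀ n, ∫ p, φ (fun i => Xn n (ts i) p.1) (τsn n p) ∂(prodLeb P) =
      ∫ p, F (Zn n p.1) (g (τsn n p)) ∂(prodLeb P) := fun n => hrw (Zn n) _ (hτsnL n)
  have e2 : ∫ p, φ (fun i => X (ts i) p.1) (τs p) ∂(prodLeb P) =
      ∫ p, F (Z p.1) (g (τs p)) ∂(prodLeb P) := hrw Z _ hτsL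
  rw [e2]
  simp_rw [e1]
  refine tendsto_of_subseq_tendsto fun ns hns => ?_
  obtain ⟨ms, hms, hX⟩ := aux_subseq P T hT X Xn hXcad hconv ns hns
  refine ⟨ms, ?_⟩
  have hj : ∀ᵐ ω ∂P, ∀ i, pathJump (fun r => X r ω) (ts i) = 0 := by
    rw [ae_all_iff]
    intro i
    exact hjump i
  have hZlim : ∀ᵐ ω ∂P, Tendsto (fun j => Zn (ns (ms j)) ω) atTop (𝓝 (Z ω)) := by
    filter_upwards [hj, hX] with ω h1 h2
    exact tendsto_pi_nhds.2 fun i => h2 _ (hts i) (h1 i)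
  have hZlim2 : ∀ᵐ p ∂(prodLeb P), Tendsto (fun j => Zn (ns (ms j)) p.1) atTop (𝓝 (Z p.1)) := by
    unfold prodLeb
    exact Measure.quasiMeasurePreserving_fst.ae hZlim
  have hFb : ∀ x s, ‖F x s‖ ≤ C := fun x s => ((F x).norm_coe_le_norm s).trans (hF x)
  have hint : ∀ (Y : Ω → Fin k → ℝ), Measurable Y → ∀ n,
      Integrable (fun p : Ω × ℝ => F (Y p.1) (g (τsn n p))) (prodLeb P) := fun Y hY n =>
    Integrable.of_bound (aux_meas F g hY (hτm n)).aestronglyMeasurable C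
      (Eventually.of_forall fun p => hFb _ _)
  have hdiff : Tendsto (fun j => ∫ p, (F (Zn (ns (ms j)) p.1) (g (τsn (ns (ms j)) p)) -
      F (Z p.1) (g (τsn (ns (ms j)) p))) ∂(prodLeb P)) atTop (𝓝 0) := by
    have := tendsto_integral_of_dominated_convergence (μ := prodLeb P)
      (F := fun j p => F (Zn (ns (ms j)) p.1) (g (τsn (ns (ms j)) p)) -
        F (Z p.1) (g (τsn (ns (ms j)) p))) (f := fun _ => (0 : ℝ)) (fun _ => C + C)
      (fun j => ((hint _ (hZn _) _).sub (hint _ hZ _)).aestronglyMeasurable) (integrable_const _)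
      (fun j => Eventually.of_forall fun p =>
        (norm_sub_le _ _).trans (add_le_add (hFb _ _) (hFb _ _)))
      (by
        filter_upwards [hZlim2] with p hp
        have h1 : Tendsto (fun j => F (Zn (ns (ms j)) p.1)) atTop (𝓝 (F (Z p.1))) :=
          (F.continuous.tendsto _).comp hp
        rw [tendsto_iff_norm_sub_tendsto_zero] at h1
        exact squeeze_zero_norm (fun j =>
          (F (Zn (ns (ms j)) p.1) - F (Z p.1)).norm_coe_le_norm (g (τsn (ns (ms j)) p))) h1)
    simpa using this
  have := hdiff.add (hst.comp hms)
  rw [zero_add] at this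
  refine this.congr fun j => ?_
  rw [integral_sub (hint _ (hZn _) _) (hint _ hZ _)]
  simp
end

section
/- Let X be a càdlàg process and ℱ the right-continuous filtration associated to its natural filtration. On (Ω × [0,1], ℱ_T ⊗ ℬ', P ⊗ μ) (ℬ' a σ-field containing ℬ) let 𝒢 = (𝒢_t) be a right-continuous filtration with ℱ_t ⊗ ℬ ⊆ 𝒢_t for every t ∈ [0,T]. Assume that for every t ∈ [0,T], 𝒢_t and ℱ_T ⊗ ℬ are conditionally independent given ℱ_t ⊗ ℬ under P ⊗ μ. Then Γ̃(L) = Γ*(L), where Γ̃(L) = sup{E_{P⊗μ}[γ(τ̃(ω,v), X_{τ̃(ω,v)}(ω))] : τ̃ a 𝒢-stopping time with τ̃ ≤ L} and Γ*(L) = sup{E_{P⊗μ}[γ(τ*(ω,v), X_{τ*(ω,v)}(ω))] : τ* a randomized ℱ-stopping time with τ* ≤ L}. -/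
open MeasureTheory Filter Set Topology

section helpers

theorem natFilt_mono' {Ω : Type*} (X : ℝ → Ω → ℝ) {s t : ℝ} (h : s ≤ t) :
    natFilt X s ≤ natFilt X t := by
  unfold natFilt
  exact biSup_mono fun u hu => ⟨hu.1, hu.2.trans h⟩

theorem rcFilt_mono' {Ω : Type*} (X : ℝ → Ω → ℝ) (T : ℝ) : Monotone (rcFilt X T) := by
  intro s t h
  unfold rcFilt
  split_ifs with h1 h2 h2
  · exact le_iInf₂ fun u hu => iInf₂_le u ⟨h.trans_lt hu.1, hu.2⟩
  · exact iInf₂_le T ⟨h1, le_rfl⟩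
  · exact absurd (h.trans_lt h2) h1
  · exact le_rfl

theorem natFilt_le_rcFilt {Ω : Type*} (X : ℝ → Ω → ℝ) {T t : ℝ} (h : t ≤ T) :
    natFilt X t ≤ rcFilt X T t := by
  unfold rcFilt
  split_ifs with h1
  · exact le_iInf₂ fun u hu => natFilt_mono' X hu.1.le
  · exact natFilt_mono' X h

theorem rcFilt_T_le {Ω : Type*} [m0 : MeasurableSpace Ω] (X : ℝ → Ω → ℝ)
    (hXm : ∀ s : ℝ, Measurable (X s)) (T : ℝ) : rcFilt X T T ≤ m0 := by
  unfold rcFilt natFilt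
  simp only [lt_self_iff_false, if_false]
  exact iSup₂_le fun s _ => (hXm s).comap_le

theorem prod_mono_left {Ω : Type*} {a b : MeasurableSpace Ω} (h : a ≤ b) :
    a.prod (borel ℝ) ≤ b.prod (borel ℝ) := by
  unfold MeasurableSpace.prod
  exact sup_le_sup (MeasurableSpace.comap_mono h) le_rfl

/-- A process with finitely/countably many indices evaluated at a random index. -/
theorem meas_eval {E : Type*} {m : MeasurableSpace E} (Z : ℕ → E → ℝ) (σ : E → ℕ)
    (hσ : ∀ j, MeasurableSet {p | σ p = j}) (hZ : ∀ j, MeasurableSet {p | σ p = j} → Measurable (Z j)) :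
    Measurable fun p => Z (σ p) p := by
  have h1 : Measurable σ := measurable_to_countable' fun j => hσ j
  have h2 : Measurable fun q : E × ℕ => Z q.2 q.1 :=
    measurable_from_prod_countable_left fun j => hZ j (hσ j)
  exact h2.comp (measurable_id.prodMk h1)

theorem path_tendsto {T L : ℝ} (hL : L ≤ T) (γ : ℝ → ℝ → ℝ)
    (hγc : ContinuousOn (fun p : ℝ × ℝ => γ p.1 p.2) (Set.Ici 0 ×ˢ Set.univ))
    (f : ℝ → ℝ) (hf : IsCadlagOn T f) (x : ℝ) (hx : x ∈ Set.Icc 0 L) :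
    Tendsto (fun n : ℕ => γ (min ((⌈((n : ℝ) + 1) * x⌉₊ : ℝ) / ((n : ℝ) + 1)) L)
      (f (min ((⌈((n : ℝ) + 1) * x⌉₊ : ℝ) / ((n : ℝ) + 1)) L))) atTop (𝓝 (γ x (f x))) := by
  set t : ℕ → ℝ := fun n => min ((⌈((n : ℝ) + 1) * x⌉₊ : ℝ) / ((n : ℝ) + 1)) L with ht
  have hge : ∀ n, x ≤ t n := fun n => by
    refine le_min ?_ hx.2
    rw [le_div_iff₀ (by positivity), mul_comm]
    exact Nat.le_ceil _
  have hle : ∀ n : ℕ, t n ≤ x + 1 / ((n : ℝ) + 1) := fun n => by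
    refine (min_le_left _ _).trans ?_
    have hp : (0 : ℝ) < (n : ℝ) + 1 := by positivity
    have e : (x + 1 / ((n : ℝ) + 1)) * ((n : ℝ) + 1) = ((n : ℝ) + 1) * x + 1 := by field_simp
    rw [div_le_iff₀ hp, e]
    exact (Nat.ceil_lt_add_one (mul_nonneg hp.le hx.1)).le
  have htx : Tendsto t atTop (𝓝 x) := by
    refine tendsto_of_tendsto_of_tendsto_of_le_of_le tendsto_const_nhds ?_ hge hle
    simpa using (tendsto_const_nhds (x := x)).add
      (tendsto_one_div_add_atTop_nhds_zero_nat (𝕜 := ℝ))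
  have hfx : Tendsto (fun n => f (t n)) atTop (𝓝 (f x)) := by
    rcases lt_or_ge x T with hxT | hxT
    · have h1 : ContinuousWithinAt f (Set.Ici x) x :=
        continuousWithinAt_Ioi_iff_Ici.1 (hf.1 x ⟨hx.1, hxT⟩)
      exact h1.tendsto.comp (tendsto_nhdsWithin_iff.2 ⟨htx, Eventually.of_forall hge⟩)
    · have : ∀ n, t n = x := fun n =>
        le_antisymm ((min_le_right _ _).trans (hL.trans hxT)) (hge n)
      simp only [this]
      exact tendsto_const_nhds
  have hc := hγc (x, f x) ⟨hx.1, trivial⟩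
  exact hc.tendsto.comp (tendsto_nhdsWithin_iff.2 ⟨htx.prodMk_nhds hfx,
    Eventually.of_forall fun n => ⟨hx.1.trans (hge n), trivial⟩⟩)

/-- From conditional independence to the immersion property. -/
theorem immersion {E : Type*} {m : MeasurableSpace E} (Q : Measure E) [IsProbabilityMeasure Q]
    (H HT : MeasurableSpace E) (hHT : H ≤ HT) (hm : HT ≤ m) (A : Set E) (hA : MeasurableSet[m] A)
    (hCI : ∀ C : Set E, MeasurableSet[HT] C →
      Q[Set.indicator (A ∩ C) (fun _ => (1 : ℝ)) | H] =ᵐ[Q] fun p =>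
        (Q[Set.indicator A (fun _ => (1 : ℝ)) | H]) p *
        (Q[Set.indicator C (fun _ => (1 : ℝ)) | H]) p)
    (f : E → ℝ) (hf : Measurable[HT] f) (C : ℝ) (hfC : ∀ p, |f p| ≤ C) :
    ∫ p in A, f p ∂Q = ∫ p in A, (Q[f | H]) p ∂Q := by
  have hHm := hHT.trans hm
  have hC0 : 0 ≤ C := by
    have := Q.nonempty_of_neZero
    exact (abs_nonneg _).trans (hfC this.some)
  set oA : E → ℝ := Set.indicator A (fun _ => (1 : ℝ)) with hoA
  have iA : Integrable oA Q := (integrable_const 1).indicator hA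
  set g : E → ℝ := Q[oA | H] with hg
  have gi : Integrable g Q := integrable_condExp
  have gsm : StronglyMeasurable[H] g := stronglyMeasurable_condExp
  -- step 1
  have h1 : g =ᵐ[Q] Q[oA | HT] := by
    refine ae_eq_condExp_of_forall_setIntegral_eq hm iA (fun _ _ _ => gi.integrableOn) ?_
      (gsm.mono hHT).aestronglyMeasurable
    intro D hD _
    have hDm := hm _ hD
    have e1 : ∫ p in D, oA p ∂Q = ∫ p, Set.indicator (A ∩ D) (fun _ => (1 : ℝ)) p ∂Q := by
      rw [← integral_indicator hDm, hoA, Set.indicator_indicator, Set.inter_comm]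
    have iD : Integrable (Set.indicator D (fun _ => (1 : ℝ))) Q := (integrable_const 1).indicator hDm
    have e3 : (fun p => g p * Set.indicator D (fun _ => (1 : ℝ)) p) = Set.indicator D g := by
      ext p; by_cases hp : p ∈ D <;> simp [hp]
    have igD : Integrable (fun p => g p * Set.indicator D (fun _ => (1 : ℝ)) p) Q := by
      rw [e3]; exact gi.indicator hDm
    have e2 : Q[fun p => g p * Set.indicator D (fun _ => (1 : ℝ)) p | H] =ᵐ[Q]
        fun p => g p * (Q[Set.indicator D (fun _ => (1 : ℝ)) | H]) p :=
      condExp_mul_of_stronglyMeasurable_left gsm igD iD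
    symm
    rw [e1, ← integral_condExp (μ := Q) (m := H) (f := Set.indicator (A ∩ D) (fun _ => (1 : ℝ))) hHm,
      integral_congr_ae ((hCI D hD).trans e2.symm),
      integral_condExp hHm, e3, integral_indicator hDm]
  -- step 2
  have fi : Integrable f Q := by
    refine (integrable_const C).mono' (hf.mono hm le_rfl).aestronglyMeasurable ?_
    exact Eventually.of_forall hfC
  have e4 : ∀ h : E → ℝ, (fun p => oA p * h p) = Set.indicator A h := by
    intro h; ext p; by_cases hp : p ∈ A <;> simp [hoA, hp]
  have gb : ∀ᵐ p ∂Q, |g p| ≤ (1 : ℝ) := by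
    refine ae_bdd_abs_condExp_of_ae_bdd_abs (R := (1 : ℝ)) (Eventually.of_forall fun p => ?_)
    by_cases hp : p ∈ A <;> simp [hoA, hp]
  have igf : Integrable (fun p => g p * f p) Q :=
    fi.bdd_mul gi.aestronglyMeasurable gb
  have hcf : StronglyMeasurable[H] (Q[f | H]) := stronglyMeasurable_condExp
  have s1 : Q[fun p => oA p * f p | HT] =ᵐ[Q] fun p => (Q[oA | HT]) p * f p := by
    refine condExp_mul_of_stronglyMeasurable_right hf.stronglyMeasurable ?_ iA
    show Integrable (fun p => oA p * f p) Q
    rw [e4]; exact fi.indicator hA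
  have s2 : Q[fun p => g p * f p | H] =ᵐ[Q] fun p => g p * (Q[f | H]) p :=
    condExp_mul_of_stronglyMeasurable_left gsm igf fi
  have s3 : Q[fun p => oA p * (Q[f | H]) p | H] =ᵐ[Q] fun p => g p * (Q[f | H]) p := by
    refine condExp_mul_of_stronglyMeasurable_right hcf ?_ iA
    show Integrable (fun p => oA p * (Q[f | H]) p) Q
    rw [e4]; exact integrable_condExp.indicator hA
  calc ∫ p in A, f p ∂Q = ∫ p, oA p * f p ∂Q := by rw [e4]; exact (integral_indicator hA).symm
    _ = ∫ p, (Q[oA | HT]) p * f p ∂Q := by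
        rw [← integral_condExp hm, integral_congr_ae s1]
    _ = ∫ p, g p * f p ∂Q := integral_congr_ae (by filter_upwards [h1] with p hp; rw [hp])
    _ = ∫ p, g p * (Q[f | H]) p ∂Q := by
        rw [← integral_condExp hHm, integral_congr_ae s2]
    _ = ∫ p, oA p * (Q[f | H]) p ∂Q := by
        rw [← integral_congr_ae s3, integral_condExp hHm]
    _ = _ := by rw [e4]; exact integral_indicator hA

/-- Backward induction in discrete time. -/
theorem discrete_snell {E : Type*} {m : MeasurableSpace E} (Q : Measure E)
    [IsProbabilityMeasure Q] (H G : ℕ → MeasurableSpace E) (HT : MeasurableSpace E)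
    (hHmono : Monotone H) (hGmono : Monotone G)
    (hHG : ∀ i, H i ≤ G i) (hHT : ∀ i, H i ≤ HT) (hHTm : HT ≤ m) (hGm : ∀ i, G i ≤ m)
    (Z : ℕ → E → ℝ) (C : ℝ) (hZb : ∀ i p, |Z i p| ≤ C) (hZ : ∀ i, Measurable[H i] (Z i))
    (himm : ∀ i A, MeasurableSet[G i] A → ∀ f : E → ℝ, Measurable[HT] f → (∀ p, |f p| ≤ C) →
      ∫ p in A, f p ∂Q = ∫ p in A, (Q[f | H i]) p ∂Q) (N : ℕ) :
    ∀ d i, i + d = N → ∃ σ : E → ℕ, (∀ p, i ≤ σ p ∧ σ p ≤ N) ∧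
      (∀ j, MeasurableSet[H j] {p | σ p = j}) ∧
      ∀ A, MeasurableSet[G i] A → ∀ τ : E → ℕ, (∀ p, i ≤ τ p ∧ τ p ≤ N) →
        (∀ j, MeasurableSet[G j] {p | τ p = j}) →
        ∫ p in A, Z (τ p) p ∂Q ≤ ∫ p in A, Z (σ p) p ∂Q := by
  have hmeas : ∀ σ : E → ℕ, (∀ j, MeasurableSet[H j] {p | σ p = j}) →
      Measurable[HT] fun p => Z (σ p) p := fun σ hσ =>
    meas_eval (m := HT) Z σ (fun j => hHT j _ (hσ j)) (fun j _ => (hZ j).mono (hHT j) le_rfl)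
  have hmeasG : ∀ τ : E → ℕ, (∀ j, MeasurableSet[G j] {p | τ p = j}) →
      Measurable[m] fun p => Z (τ p) p := fun σ hσ =>
    meas_eval (m := m) Z σ (fun j => hGm j _ (hσ j))
      (fun j _ => (hZ j).mono ((hHT j).trans hHTm) le_rfl)
  have hIntg : ∀ f : E → ℝ, Measurable[m] f → (∀ p, |f p| ≤ C) → Integrable f Q :=
    fun f hf hb => (integrable_const C).mono' hf.aestronglyMeasurable (Eventually.of_forall hb)
  intro d
  induction d with
  | zero =>
    intro i hi
    obtain rfl : i = N := by omega
    refine ⟨fun _ => i, fun _ => ⟨le_rfl, le_rfl⟩, fun j => @MeasurableSet.const E (H j) _, ?_⟩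
    intro A _ τ hτ _
    refine le_of_eq ?_
    congr 1
    ext p
    rw [le_antisymm (hτ p).2 (hτ p).1]
  | succ d ih =>
    intro i hi
    obtain ⟨σ', hσ'r, hσ'm, hσ'opt⟩ := ih (i + 1) (by omega)
    have hW := hmeas σ' hσ'm
    have hWb : ∀ p, |Z (σ' p) p| ≤ C := fun p => hZb _ p
    have hWi := hIntg _ (hW.mono hHTm le_rfl) hWb
    set V : E → ℝ := Q[fun p => Z (σ' p) p | H i] with hV
    have hVm : Measurable[H i] V := stronglyMeasurable_condExp.measurable
    have hVi : Integrable V Q := integrable_condExp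
    have hD : MeasurableSet[H i] {p | V p ≤ Z i p} := measurableSet_le hVm (hZ i)
    set D : Set E := {p | V p ≤ Z i p} with hDdef
    classical
    refine ⟨fun p => if p ∈ D then i else σ' p, ?_, ?_, ?_⟩
    · intro p
      by_cases hp : p ∈ D
      · simp only [hp, if_true]; omega
      · simp only [hp, if_false]; have := hσ'r p; omega
    · intro j
      rcases lt_trichotomy j i with hj | hj | hj
      · have : {p | (if p ∈ D then i else σ' p) = j} = ∅ := by
          ext p
          have := hσ'r p
          by_cases hp : p ∈ D <;> simp [hp] <;> omega
        rw [this]; exact @MeasurableSet.empty E (H j)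
      · have : {p | (if p ∈ D then i else σ' p) = j} = D := by
          ext p
          have := hσ'r p
          by_cases hp : p ∈ D <;> simp [hp] <;> omega
        rw [this, hj]; exact hD
      · have : {p | (if p ∈ D then i else σ' p) = j} = Dᶜ ∩ {p | σ' p = j} := by
          ext p
          by_cases hp : p ∈ D <;> simp [hp]; omega
        rw [this]
        exact @MeasurableSet.inter E (H j) _ _ (hHmono hj.le _ (@MeasurableSet.compl E _ (H i) hD)) (hσ'm j)
    · intro A hA τ hτr hτm
      have hZi : Integrable (Z i) Q := hIntg _ ((hZ i).mono ((hHT i).trans hHTm) le_rfl) (hZb i)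
      have hτi := hIntg _ (hmeasG τ hτm) (fun p => hZb _ p)
      set B : Set E := {p | τ p = i} with hB
      have hBm : MeasurableSet[G i] B := hτm i
      have hDm : MeasurableSet[G i] D := hHG i _ hD
      have hDm' : MeasurableSet[m] D := hGm i _ hDm
      have hBm' : MeasurableSet[m] B := hGm i _ hBm
      have hAm' : MeasurableSet[m] A := hGm i _ hA
      -- the improved stopping time
      have k1 : ∫ p in A \ B, Z (τ p) p ∂Q ≤ ∫ p in A \ B, V p ∂Q := by
        rw [← himm i (A \ B) (hA.diff hBm) _ hW hWb]
        refine le_trans (le_of_eq ?_) (hσ'opt (A \ B) (hGmono (Nat.le_succ i) _ (hA.diff hBm))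
          (fun p => max (τ p) (i + 1)) ?_ ?_)
        · refine setIntegral_congr_fun (hAm'.diff hBm') fun p hp => ?_
          have h1 : τ p ≠ i := hp.2
          have := hτr p
          have h2 : max (τ p) (i + 1) = τ p := by omega
          simp only [h2]
        · intro p; have := hτr p; constructor <;> omega
        · intro j
          rcases lt_trichotomy j (i + 1) with hj | hj | hj
          · have : {p | max (τ p) (i + 1) = j} = ∅ := by
              ext p; simp; omega
            rw [this]; exact @MeasurableSet.empty E (G j)
          · have : {p | max (τ p) (i + 1) = j} = {p | τ p = i} ∪ {p | τ p = i + 1} := by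
              ext p; have := hτr p; simp; omega
            rw [this, hj]
            exact @MeasurableSet.union E (G (i + 1)) _ _ (hGmono (Nat.le_succ i) _ hBm) (hτm _)
          · have : {p | max (τ p) (i + 1) = j} = {p | τ p = j} := by
              ext p; simp; omega
            rw [this]; exact hτm j
      have k2 : ∫ p in A ∩ B, Z (τ p) p ∂Q = ∫ p in A ∩ B, Z i p ∂Q := by
        refine setIntegral_congr_fun (hAm'.inter hBm') fun p hp => ?_
        have h1 : τ p = i := hp.2
        simp only [h1]
      have hmax : Integrable (fun p => max (Z i p) (V p)) Q := hZi.sup hVi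
      have k3 : ∫ p in A, Z (τ p) p ∂Q ≤ ∫ p in A, max (Z i p) (V p) ∂Q := by
        rw [← integral_inter_add_sdiff hBm' hτi.integrableOn,
          ← integral_inter_add_sdiff hBm' hmax.integrableOn, k2]
        refine add_le_add ?_ (k1.trans ?_)
        · exact integral_mono hZi.integrableOn hmax.integrableOn fun p => le_max_left _ _
        · exact integral_mono hVi.integrableOn hmax.integrableOn fun p => le_max_right _ _
      refine k3.trans (le_of_eq ?_)
      have hσi : Integrable (fun p => Z (if p ∈ D then i else σ' p) p) Q := by
        have : (fun p => Z (if p ∈ D then i else σ' p) p)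
            = fun p => if p ∈ D then Z i p else Z (σ' p) p := by
          ext p; split_ifs <;> rfl
        rw [this]
        refine hIntg _ (Measurable.ite hDm' ((hZ i).mono ((hHT i).trans hHTm) le_rfl)
          (hW.mono hHTm le_rfl)) ?_
        intro p; split_ifs <;> exact hZb _ _
      rw [← integral_inter_add_sdiff hDm' hmax.integrableOn,
        ← integral_inter_add_sdiff hDm' hσi.integrableOn]
      congr 1
      · refine setIntegral_congr_fun (hAm'.inter hDm') fun p hp => ?_
        have h1 : p ∈ D := hp.2
        have h2 : V p ≤ Z i p := hp.2
        simp only [h1, if_true, max_eq_left h2]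
      · have e1 : ∫ p in A \ D, max (Z i p) (V p) ∂Q = ∫ p in A \ D, V p ∂Q := by
          refine setIntegral_congr_fun (hAm'.diff hDm') fun p hp => ?_
          have h2 : ¬ V p ≤ Z i p := hp.2
          simp only [max_eq_right (not_le.1 h2).le]
        rw [e1, ← himm i (A \ D) (hA.diff hDm) _ hW hWb]
        refine setIntegral_congr_fun (hAm'.diff hDm') fun p hp => ?_
        have h1 : p ∉ D := hp.2
        simp only [h1, if_false]

end helpers

/-- (Lemma `indepcond`.) If `𝒢` is a right-continuous filtration
on `Ω × [0,1]` containing `ℱ_t ⊗ ℬ`, such that for every `t` the σ-fields `𝒢_t` and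
`ℱ_T ⊗ ℬ` are conditionally independent given `ℱ_t ⊗ ℬ`, then the optimal value over
`𝒢`-stopping times bounded by `L` equals the optimal value over randomized
`ℱ`-stopping times bounded by `L`. -/
theorem enlarged_filtration_value_eq_randomized_value
    {Ω : Type*} [m0 : MeasurableSpace Ω] (P : Measure Ω) [IsProbabilityMeasure P]
    (T L : ℝ) (hT : 0 < T) (hL : L ∈ Set.Icc 0 T)
    (γ : ℝ → ℝ → ℝ)
    (hγc : ContinuousOn (fun p : ℝ × ℝ => γ p.1 p.2) (Set.Ici 0 ×ˢ Set.univ))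
    (hγb : ∃ C : ℝ, ∀ t ∈ Set.Ici (0 : ℝ), ∀ y : ℝ, |γ t y| ≤ C)
    (X : ℝ → Ω → ℝ) (hXm : ∀ s : ℝ, Measurable (X s))
    (hXcad : ∀ ω, IsCadlagOn T (fun t => X t ω))
    (Q : Measure (Ω × ℝ)) [IsProbabilityMeasure Q]
    (hQ : ∀ s : Set (Ω × ℝ), MeasurableSet[(rcFilt X T T).prod (borel ℝ)] s →
      Q s = prodLeb P s)
    (G : ℝ → MeasurableSpace (Ω × ℝ)) (hGmono : Monotone G)
    (hGle : ∀ t, G t ≤ (inferInstance : MeasurableSpace (Ω × ℝ)))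
    (hGrc : ∀ t, t < T → G t = ⨅ s ∈ Set.Ioc t T, G s)
    (hFG : ∀ t ∈ Set.Icc (0 : ℝ) T, (rcFilt X T t).prod (borel ℝ) ≤ G t)
    (hCI : ∀ t ∈ Set.Icc (0 : ℝ) T,
      ∀ C₁ : Set (Ω × ℝ), MeasurableSet[G t] C₁ →
      ∀ C₂ : Set (Ω × ℝ), MeasurableSet[(rcFilt X T T).prod (borel ℝ)] C₂ →
        Q[Set.indicator (C₁ ∩ C₂) (fun _ => (1 : ℝ)) | (rcFilt X T t).prod (borel ℝ)]
          =ᵐ[Q] fun p =>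
            (Q[Set.indicator C₁ (fun _ => (1 : ℝ)) | (rcFilt X T t).prod (borel ℝ)]) p *
            (Q[Set.indicator C₂ (fun _ => (1 : ℝ)) | (rcFilt X T t).prod (borel ℝ)]) p) :
    sSup {x | ∃ τt : Ω × ℝ → ℝ,
        (∀ t : ℝ, MeasurableSet[G t] {p : Ω × ℝ | τt p ≤ t}) ∧
        (∀ ω : Ω, ∀ v ∈ Set.Icc (0 : ℝ) 1, τt (ω, v) ∈ Set.Icc 0 L) ∧
        x = ∫ p, γ (τt p) (X (τt p) p.1) ∂Q}
      = sSup {x | ∃ τs : Ω × ℝ → ℝ,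
        (∀ t : ℝ, MeasurableSet[(rcFilt X T t).prod (borel ℝ)] {p : Ω × ℝ | τs p ≤ t}) ∧
        (∀ ω : Ω, ∀ v ∈ Set.Icc (0 : ℝ) 1, τs (ω, v) ∈ Set.Icc 0 L) ∧
        x = ∫ p, γ (τs p) (X (τs p) p.1) ∂(prodLeb P)} := by
  classical
  obtain ⟨C, hC⟩ := hγb
  obtain ⟨hL0, hLT⟩ := hL
  set H : ℝ → MeasurableSpace (Ω × ℝ) := fun t => (rcFilt X T t).prod (borel ℝ) with hH
  have hHmono : Monotone H := fun s t h => prod_mono_left (rcFilt_mono' X T h)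
  have hHTm : H T ≤ (inferInstance : MeasurableSpace (Ω × ℝ)) :=
    prod_mono_left (rcFilt_T_le X hXm T)
  have hsnd : ∀ t, Measurable[H t, borel ℝ] (Prod.snd : Ω × ℝ → ℝ) := fun t =>
    @measurable_snd Ω ℝ (rcFilt X T t) (borel ℝ)
  have hfst : ∀ t, @Measurable _ _ (H t) (rcFilt X T t) (Prod.fst : Ω × ℝ → Ω) := fun t =>
    @measurable_fst Ω ℝ (rcFilt X T t) (borel ℝ)
  have hI : ∀ t, MeasurableSet[H t] {p : Ω × ℝ | p.2 ∈ Set.Icc (0 : ℝ) 1} := fun t =>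
    hsnd t (measurableSet_Icc : MeasurableSet (Set.Icc (0 : ℝ) 1))
  have hZm : ∀ t ∈ Set.Icc (0 : ℝ) T, Measurable[H t] fun p : Ω × ℝ => γ t (X t p.1) := by
    intro t ht
    have c1 : Continuous (γ t) := by
      have : ContinuousOn (fun y : ℝ => γ t y) Set.univ :=
        hγc.comp (f := fun y : ℝ => (t, y)) (by fun_prop) (fun y _ => ⟨ht.1, trivial⟩)
      exact continuousOn_univ.1 this
    have c2 : Measurable[rcFilt X T t] (X t) := by
      have h3 : MeasurableSpace.comap (X t) (borel ℝ) ≤ rcFilt X T t :=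
        le_trans (le_iSup₂_of_le (f := fun s (_ : s ∈ Set.Icc (0 : ℝ) t) =>
          MeasurableSpace.comap (X s) (borel ℝ)) t ⟨ht.1, le_rfl⟩ le_rfl)
          (natFilt_le_rcFilt X ht.2)
      exact measurable_iff_comap_le.2 h3
    exact c1.measurable.comp (c2.comp (hfst t))
  haveI : IsProbabilityMeasure ((volume : Measure ℝ).restrict (Set.Icc 0 1)) :=
    ⟨by simp⟩
  haveI : IsProbabilityMeasure (prodLeb P) := by unfold prodLeb; infer_instance
  have hRae : ∀ᵐ p ∂(prodLeb P), p.2 ∈ Set.Icc (0 : ℝ) 1 := by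
    have h1 : ∀ᵐ v ∂((volume : Measure ℝ).restrict (Set.Icc 0 1)), v ∈ Set.Icc (0 : ℝ) 1 :=
      ae_restrict_mem measurableSet_Icc
    exact Measure.quasiMeasurePreserving_snd.ae h1
  have hQae : ∀ᵐ p ∂Q, p.2 ∈ Set.Icc (0 : ℝ) 1 := by
    have := hQ _ (@MeasurableSet.compl _ _ (H T) (hI T))
    rw [ae_iff] at hRae ⊢
    exact this.trans hRae
  have htrim : Q.trim hHTm = (prodLeb P).trim hHTm := by
    refine @Measure.ext _ (H T) _ _ fun s hs => ?_
    rw [trim_measurableSet_eq hHTm hs, trim_measurableSet_eq hHTm hs]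
    exact hQ s hs
  have hIntg : ∀ f : Ω × ℝ → ℝ, Measurable[H T] f → ∫ p, f p ∂Q = ∫ p, f p ∂(prodLeb P) := by
    intro f hf
    have hs : StronglyMeasurable[H T] f := hf.stronglyMeasurable
    rw [integral_trim hHTm hs, integral_trim hHTm hs, htrim]
  have hbd : ∀ (R : Measure (Ω × ℝ)) [IsProbabilityMeasure R],
      (∀ᵐ p ∂(R), p.2 ∈ Set.Icc (0 : ℝ) 1) → ∀ τ : Ω × ℝ → ℝ,
      (∀ ω : Ω, ∀ v ∈ Set.Icc (0 : ℝ) 1, τ (ω, v) ∈ Set.Icc 0 L) →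
      ∫ p, γ (τ p) (X (τ p) p.1) ∂(R) ≤ C := by
    intro R _ hR τ hτ
    have := norm_integral_le_of_norm_le_const (μ := R) (C := C)
      (f := fun p => γ (τ p) (X (τ p) p.1)) (by
        filter_upwards [hR] with p hp
        exact hC _ (hτ p.1 p.2 hp).1 _)
    rw [probReal_univ, mul_one] at this
    exact (le_abs_self _).trans this
  -- modification outside `[0,1]`
  set md : (Ω × ℝ → ℝ) → Ω × ℝ → ℝ := fun τ p => if p.2 ∈ Set.Icc (0 : ℝ) 1 then τ p else L
    with hmd
  have hmdr : ∀ τ : Ω × ℝ → ℝ,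
      (∀ ω : Ω, ∀ v ∈ Set.Icc (0 : ℝ) 1, τ (ω, v) ∈ Set.Icc 0 L) →
      ∀ p, md τ p ∈ Set.Icc 0 L := by
    intro τ hτ p
    by_cases hp : p.2 ∈ Set.Icc (0 : ℝ) 1
    · simp only [hmd, hp, if_true]; exact hτ p.1 p.2 hp
    · simp only [hmd, hp, if_false]; exact ⟨hL0, le_rfl⟩
  have hmdint : ∀ (R : Measure (Ω × ℝ)), (∀ᵐ p ∂(R), p.2 ∈ Set.Icc (0 : ℝ) 1) →
      ∀ τ : Ω × ℝ → ℝ,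
      ∫ p, γ (τ p) (X (τ p) p.1) ∂(R) = ∫ p, γ (md τ p) (X (md τ p) p.1) ∂(R) := by
    intro R hR τ
    refine integral_congr_ae ?_
    filter_upwards [hR] with p hp
    simp only [hmd, hp, if_true]
  have hmdm : ∀ K : ℝ → MeasurableSpace (Ω × ℝ), (∀ t ∈ Set.Icc (0 : ℝ) T, H t ≤ K t) →
      ∀ τ : Ω × ℝ → ℝ, (∀ t ∈ Set.Icc (0 : ℝ) T, MeasurableSet[K t] {p : Ω × ℝ | τ p ≤ t}) →
      (∀ ω : Ω, ∀ v ∈ Set.Icc (0 : ℝ) 1, τ (ω, v) ∈ Set.Icc 0 L) →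
      ∀ t, MeasurableSet[K t] {p : Ω × ℝ | md τ p ≤ t} := by
    intro K hK τ hτ hτr t
    have hr := hmdr τ hτr
    rcases lt_or_ge t 0 with ht | ht
    · have : {p : Ω × ℝ | md τ p ≤ t} = ∅ := by
        ext p; have := (hr p).1; simp; linarith
      rw [this]; exact @MeasurableSet.empty _ (K t)
    rcases lt_or_ge t L with htL | htL
    · have htT : t ∈ Set.Icc (0 : ℝ) T := ⟨ht, htL.le.trans hLT⟩
      have : {p : Ω × ℝ | md τ p ≤ t} = {p : Ω × ℝ | p.2 ∈ Set.Icc (0 : ℝ) 1} ∩ {p | τ p ≤ t} := by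
        ext p
        by_cases hp : p.2 ∈ Set.Icc (0 : ℝ) 1
        · simp only [hmd, hp, if_true, Set.mem_setOf_eq, Set.mem_inter_iff, true_and]
        · simp only [hmd, hp, if_false, Set.mem_setOf_eq, Set.mem_inter_iff, false_and,
            iff_false, not_le]
          exact htL
      rw [this]
      exact @MeasurableSet.inter _ (K t) _ _ (hK t htT _ (hI t)) (hτ t htT)
    · have : {p : Ω × ℝ | md τ p ≤ t} = Set.univ := by
        ext p; have := (hr p).2; simp; linarith
      rw [this]; exact @MeasurableSet.univ _ (K t)
  -- grids
  set tn : ℕ → ℕ → ℝ := fun n j => min ((j : ℝ) / ((n : ℝ) + 1)) L with htn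
  have htn_mem : ∀ n j, tn n j ∈ Set.Icc 0 L := fun n j =>
    ⟨le_min (by positivity) hL0, min_le_right _ _⟩
  have htn_memT : ∀ n j, tn n j ∈ Set.Icc 0 T := fun n j =>
    ⟨(htn_mem n j).1, (htn_mem n j).2.trans hLT⟩
  have htn_mono : ∀ n, Monotone (tn n) := fun n i j h =>
    min_le_min_right _ (div_le_div_of_nonneg_right (by exact_mod_cast h) (by positivity))
  set Z : ℕ → ℕ → Ω × ℝ → ℝ := fun n j p => γ (tn n j) (X (tn n j) p.1) with hZ
  have hZH : ∀ n j, Measurable[H (tn n j)] (Z n j) := fun n j => hZm _ (htn_memT n j)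
  have hZHT : ∀ n j, Measurable[H T] (Z n j) := fun n j =>
    (hZH n j).mono (hHmono (htn_memT n j).2) le_rfl
  have hZb : ∀ n j p, |Z n j p| ≤ C := fun n j p => hC _ (htn_mem n j).1 _
  set kn : ℕ → (Ω × ℝ → ℝ) → Ω × ℝ → ℕ := fun n τ p => ⌈((n : ℝ) + 1) * τ p⌉₊ with hkn
  have hconv : ∀ τ : Ω × ℝ → ℝ, (∀ p, τ p ∈ Set.Icc 0 L) → ∀ p,
      Tendsto (fun n => Z n (kn n τ p) p) atTop (𝓝 (γ (τ p) (X (τ p) p.1))) := fun τ hτ p =>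
    path_tendsto hLT γ hγc (fun t => X t p.1) (hXcad p.1) (τ p) (hτ p)
  have hkm : ∀ K : ℝ → MeasurableSpace (Ω × ℝ), Monotone K → ∀ τ : Ω × ℝ → ℝ,
      (∀ t, MeasurableSet[K t] {p : Ω × ℝ | τ p ≤ t}) → (∀ p, τ p ∈ Set.Icc 0 L) →
      ∀ n j, MeasurableSet[K (tn n j)] {p | kn n τ p = j} := by
    intro K hKm τ hτ hτr n
    have h1 : ∀ j, MeasurableSet[K (tn n j)] {p | kn n τ p ≤ j} := by
      intro j
      have hp : (0 : ℝ) < (n : ℝ) + 1 := by positivity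
      have : {p | kn n τ p ≤ j} = {p | τ p ≤ tn n j} := by
        ext p
        simp only [hkn, htn, Set.mem_setOf_eq, Nat.ceil_le, le_min_iff, (hτr p).2, and_true]
        rw [le_div_iff₀ hp, mul_comm]
      rw [this]; exact hτ _
    intro j
    cases j with
    | zero =>
      have : {p | kn n τ p = 0} = {p | kn n τ p ≤ 0} := by ext p; simp
      rw [this]; exact h1 0
    | succ j =>
      have : {p | kn n τ p = j + 1} = {p | kn n τ p ≤ j + 1} \ {p | kn n τ p ≤ j} := by
        ext p; simp only [Set.mem_setOf_eq, Set.mem_sdiff]; omega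
      rw [this]
      exact @MeasurableSet.diff _ (K (tn n (j + 1))) _ _ (h1 _)
        (hKm (htn_mono n (Nat.le_succ j)) _ (h1 j))
  have hpay : ∀ τ : Ω × ℝ → ℝ, (∀ t, MeasurableSet[H t] {p : Ω × ℝ | τ p ≤ t}) →
      (∀ p, τ p ∈ Set.Icc 0 L) → Measurable[H T] fun p => γ (τ p) (X (τ p) p.1) := by
    intro τ hτ hτr
    refine @measurable_of_tendsto_metrizable _ _ (H T) _ _ _ _
      (fun n p => Z n (kn n τ p) p) _ (fun n => ?_) (tendsto_pi_nhds.2 (hconv τ hτr))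
    exact meas_eval (m := H T) (Z n) (kn n τ)
      (fun j => hHmono (htn_memT n j).2 _ (hkm H hHmono τ hτ hτr n j)) (fun j _ => hZHT n j)
  have hconst : ∀ K : ℝ → MeasurableSpace (Ω × ℝ),
      ∀ t, MeasurableSet[K t] {p : Ω × ℝ | (fun _ => L : Ω × ℝ → ℝ) p ≤ t} :=
    fun K t => @MeasurableSet.const _ (K t) _
  apply le_antisymm
  · refine csSup_le ⟨_, fun _ => L, hconst G, fun _ _ _ => ⟨hL0, le_rfl⟩, rfl⟩ ?_
    rintro x ⟨τ, hτ, hτr, rfl⟩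
    rw [hmdint Q hQae τ]
    have hm := hmdm G hFG τ (fun t _ => hτ t) hτr
    have hr := hmdr τ hτr
    set τ' := md τ with hτ'
    have hkG := hkm G hGmono τ' hm hr
    have hlim : Tendsto (fun n => ∫ p, Z n (kn n τ' p) p ∂Q) atTop
        (𝓝 (∫ p, γ (τ' p) (X (τ' p) p.1) ∂Q)) := by
      refine tendsto_integral_of_dominated_convergence (fun _ => C) (fun n => ?_)
        (integrable_const C) (fun n => Eventually.of_forall fun p => hZb n _ p)
        (Eventually.of_forall (hconv τ' hr))
      exact (meas_eval (Z n) (kn n τ') (fun j => hGle _ _ (hkG n j))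
        (fun j _ => (hZHT n j).mono hHTm le_rfl)).aestronglyMeasurable
    refine le_of_tendsto' hlim fun n => ?_
    set N : ℕ := ⌈((n : ℝ) + 1) * L⌉₊ with hN
    obtain ⟨σ, hσr, hσm, hσopt⟩ := discrete_snell Q (fun i => H (tn n i)) (fun i => G (tn n i))
      (H T) (hHmono.comp (htn_mono n)) (hGmono.comp (htn_mono n))
      (fun i => hFG _ (htn_memT n i)) (fun i => hHmono (htn_memT n i).2) hHTm (fun i => hGle _)
      (Z n) C (hZb n) (hZH n)
      (fun i A hA f hf hfC => immersion Q (H (tn n i)) (H T) (hHmono (htn_memT n i).2) hHTm A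
        (hGle _ _ hA) (fun D hD => hCI _ (htn_memT n i) A hA D hD) f hf C hfC)
      N N 0 (Nat.zero_add N)
    have h1 := hσopt Set.univ (@MeasurableSet.univ _ (G (tn n 0))) (kn n τ') (fun p =>
      ⟨Nat.zero_le _, Nat.ceil_le_ceil (mul_le_mul_of_nonneg_left (hr p).2 (by positivity))⟩)
      (hkG n)
    simp only [Measure.restrict_univ] at h1
    refine h1.trans ?_
    rw [hIntg _ (meas_eval (m := H T) (Z n) σ
      (fun j => hHmono (htn_memT n j).2 _ (hσm j)) (fun j _ => hZHT n j))]
    refine le_csSup ⟨C, ?_⟩ ⟨fun p => tn n (σ p), ?_, fun ω v _ => htn_mem n _, rfl⟩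
    · rintro y ⟨τs, _, hr', rfl⟩
      exact hbd _ hRae τs hr'
    · intro t
      have : {p | tn n (σ p) ≤ t} = ⋃ j ∈ {j | tn n j ≤ t}, {p | σ p = j} := by
        ext p; simp
      rw [this]
      exact @MeasurableSet.biUnion _ _ (H t) _ _ (Set.to_countable _)
        fun j hj => hHmono hj _ (hσm j)
  · refine csSup_le ⟨_, fun _ => L, hconst H, fun _ _ _ => ⟨hL0, le_rfl⟩, rfl⟩ ?_
    rintro x ⟨τ, hτ, hτr, rfl⟩
    have hmH := hmdm H (fun _ _ => le_rfl) τ (fun t _ => hτ t) hτr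
    have hmG := hmdm G hFG τ (fun t ht => hFG t ht _ (hτ t)) hτr
    have hr := hmdr τ hτr
    rw [hmdint _ hRae τ, ← hIntg _ (hpay _ hmH hr)]
    refine le_csSup ⟨C, ?_⟩ ⟨md τ, hmG, fun ω v _ => hr _, rfl⟩
    rintro y ⟨τs, _, hr', rfl⟩
    exact hbd _ hQae τs hr'
end
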